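/- arXiv:2107.10900 — 2 statements merged into one kernel-verified Lean document; each statement's English description precedes it below -/
import Mathlib

section
/- For every ε > 0 there exists a constant C = C(ε) such that the following holds for every real X ≥ 1 and every positive integer n: writing n = ab with a powerful, b squarefree and gcd(a,b) = 1, the number of pairs (K,R), where K is a cubic subfield of a fixed algebraic closure of ℚ and R ⊆ O_K is a subring of additive index exactly n with n²·|Δ(K)| < X, is at most C·X^{1+ε}/(a^{5/3}·b²). -/
open scoped Classical
noncomputable section

/-- A fixed algebraic closure of `ℚ`. -/
abbrev Qbar : Type := AlgebraicClosure ℚ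

instance (K : IntermediateField ℚ Qbar) [FiniteDimensional ℚ ↥K] : NumberField ↥K := ⟨⟩

/-- Discriminant of a subfield of `Qbar` (junk value `0` if infinite-dimensional). -/
def discrOf (K : IntermediateField ℚ Qbar) : ℤ :=
  if _h : FiniteDimensional ℚ ↥K then NumberField.discr ↥K else 0

/-- A positive integer is powerful if `p ∣ a` implies `p² ∣ a` for every prime `p`. -/
def IsPowerful (a : ℕ) : Prop := ∀ p : ℕ, p.Prime → p ∣ a → p ^ 2 ∣ a

theorem Set.finite_and_ncard_le_of_forall_finset {α : Type*} {S : Set α} {B : ℝ}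
    (h : ∀ T : Finset α, (T : Set α) ⊆ S → (T.card : ℝ) ≤ B) :
    S.Finite ∧ (S.ncard : ℝ) ≤ B := by
  have hfin : S.Finite := by
    by_contra hS
    obtain ⟨T, hT, hc⟩ := Set.Infinite.exists_subset_card_eq hS (⌊B⌋₊ + 1)
    have := h T hT
    rw [hc] at this
    push_cast at this
    linarith [Nat.lt_floor_add_one B]
  refine ⟨hfin, ?_⟩
  rw [Set.ncard_eq_toFinset_card S hfin]
  exact h _ (by simp)

/-- The weight `max 1 |x|` of an integer. -/
def intWeight (x : ℤ) : ℝ := max 1 |(x : ℝ)|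

theorem one_le_intWeight (x : ℤ) : 1 ≤ intWeight x := le_max_left _ _

theorem intWeight_pos (x : ℤ) : 0 < intWeight x := one_pos.trans_le (one_le_intWeight x)

theorem summable_intWeight_rpow {s : ℝ} (hs : 1 < s) :
    Summable fun x : ℤ => intWeight x ^ (-s) := by
  have h := Real.summable_abs_int_rpow hs
  have h0 : Summable fun x : ℤ => if x = 0 then (1 : ℝ) else 0 :=
    summable_of_ne_finset_zero (s := {0}) (by intro b hb; simp at hb; simp [hb])
  refine (h.add h0).of_nonneg_of_le (fun x => (Real.rpow_pos_of_pos (intWeight_pos x) _).le) ?_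
  intro x
  by_cases hx : x = 0
  · subst hx
    simp only [intWeight, Int.cast_zero, abs_zero, if_true]
    rw [max_eq_left zero_le_one, Real.one_rpow]
    have := Real.rpow_nonneg (le_refl (0 : ℝ)) (-s)
    linarith
  · have h1 : (1 : ℝ) ≤ |(x : ℝ)| := by exact_mod_cast Int.one_le_abs hx
    simp [intWeight, hx, max_eq_right h1]

theorem ncard_intWeight_prod_le {s : ℝ} (hs : 1 < s) :
    ∃ C > (0 : ℝ), ∀ Z : ℝ, 0 < Z →
      {v : ℤ × ℤ × ℤ × ℤ | intWeight v.1 * (intWeight v.2.1 *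
        (intWeight v.2.2.1 * intWeight v.2.2.2)) ≤ Z}.Finite ∧
      ({v : ℤ × ℤ × ℤ × ℤ | intWeight v.1 * (intWeight v.2.1 *
        (intWeight v.2.2.1 * intWeight v.2.2.2)) ≤ Z}.ncard : ℝ) ≤ C * Z ^ s := by
  have h1 := summable_intWeight_rpow hs
  have hn : ∀ x : ℤ, 0 ≤ intWeight x ^ (-s) := fun x =>
    (Real.rpow_pos_of_pos (intWeight_pos x) _).le
  have h2 := h1.mul_of_nonneg h1 hn hn
  have h3 := h1.mul_of_nonneg h2 hn (fun x => mul_nonneg (hn _) (hn _))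
  have h4 := h1.mul_of_nonneg h3 hn (fun x => mul_nonneg (hn _) (mul_nonneg (hn _) (hn _)))
  set F : ℤ × ℤ × ℤ × ℤ → ℝ := fun v => intWeight v.1 ^ (-s) * (intWeight v.2.1 ^ (-s) *
    (intWeight v.2.2.1 ^ (-s) * intWeight v.2.2.2 ^ (-s))) with hF
  have hF0 : ∀ v, 0 ≤ F v := fun v =>
    mul_nonneg (hn _) (mul_nonneg (hn _) (mul_nonneg (hn _) (hn _)))
  have h4' : Summable F := h4
  refine ⟨∑' v, F v + 1, by linarith [show (0 : ℝ) ≤ ∑' v, F v from tsum_nonneg hF0],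
    fun Z hZ => ?_⟩
  apply Set.finite_and_ncard_le_of_forall_finset
  intro T hT
  have hZs : 0 < Z ^ s := Real.rpow_pos_of_pos hZ s
  have key : ∀ v ∈ T, Z ^ (-s) ≤ F v := by
    intro v hv
    have hv' := hT hv
    simp only [Set.mem_ofPred_eq] at hv'
    have p1 := intWeight_pos v.1
    have p2 := intWeight_pos v.2.1
    have p3 := intWeight_pos v.2.2.1
    have p4 := intWeight_pos v.2.2.2
    simp only [hF]
    rw [← Real.mul_rpow p3.le p4.le, ← Real.mul_rpow p2.le (by positivity),
      ← Real.mul_rpow p1.le (by positivity)]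
    exact Real.rpow_le_rpow_of_nonpos (by positivity) hv' (by linarith)
  have h5 : (T.card : ℝ) * Z ^ (-s) ≤ ∑' v, F v := by
    calc (T.card : ℝ) * Z ^ (-s) = ∑ v ∈ T, Z ^ (-s) := by simp
      _ ≤ ∑ v ∈ T, F v := Finset.sum_le_sum key
      _ ≤ _ := h4'.sum_le_tsum T (fun v _ => hF0 v)
  rw [Real.rpow_neg hZ.le, ← div_eq_mul_inv, div_le_iff₀ hZs] at h5
  nlinarith

theorem exists_succ_le_mul_pow {r : ℝ} (hr : 1 < r) :
    ∃ A : ℝ, 1 ≤ A ∧ ∀ k : ℕ, (k : ℝ) + 1 ≤ A * r ^ k := by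
  have hpos : 0 < r - 1 := by linarith
  refine ⟨1 + 1 / (r - 1), by simp [hpos.le], fun k => ?_⟩
  have hb : 1 + (k : ℝ) * (r - 1) ≤ r ^ k := by
    have := one_add_mul_le_pow (a := r - 1) (by linarith) k
    simpa using this
  have h2 : (k : ℝ) ≤ r ^ k / (r - 1) := by
    rw [le_div_iff₀ hpos]; linarith
  have h3 : (1 : ℝ) ≤ r ^ k := one_le_pow₀ hr.le
  calc (k : ℝ) + 1 ≤ r ^ k / (r - 1) + r ^ k := by linarith
    _ = _ := by ring

theorem card_divisors_le_mul_rpow {ε : ℝ} (hε : 0 < ε) :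
    ∃ C > (0 : ℝ), ∀ n : ℕ, 0 < n → (n.divisors.card : ℝ) ≤ C * (n : ℝ) ^ ε := by
  have h2ε : (1 : ℝ) < 2 ^ ε := Real.one_lt_rpow one_lt_two hε
  obtain ⟨A, hA1, hA⟩ := exists_succ_le_mul_pow h2ε
  obtain ⟨P, hP⟩ := exists_nat_ge ((2 : ℝ) ^ (1 / ε))
  have hA0 : 0 < A := by linarith
  refine ⟨A ^ P, by positivity, fun n hn => ?_⟩
  have hn0 : n ≠ 0 := hn.ne'
  rw [Nat.card_divisors hn0]
  have hnprod : (n : ℝ) ^ ε = ∏ p ∈ n.primeFactors, ((p : ℝ) ^ ε) ^ (n.factorization p) := by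
    conv_lhs => rw [← Nat.prod_factorization_pow_eq_self hn0]
    rw [Finsupp.prod, Nat.support_factorization]
    push_cast
    rw [← Real.finsetProd_rpow _ _ (fun i _ => by positivity)]
    refine Finset.prod_congr rfl fun p _ => ?_
    rw [← Real.rpow_natCast, ← Real.rpow_natCast, ← Real.rpow_mul (by positivity),
      ← Real.rpow_mul (by positivity), mul_comm]
  rw [hnprod]
  push_cast
  have hstep : ∀ p ∈ n.primeFactors, ((n.factorization p : ℝ) + 1) ≤
      (if p < P then A else 1) * ((p : ℝ) ^ ε) ^ (n.factorization p) := by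
    intro p hp
    have hp2 : (2 : ℝ) ≤ p := by exact_mod_cast (Nat.prime_of_mem_primeFactors hp).two_le
    split_ifs with h
    · refine (hA _).trans ?_
      gcongr
    · have : (2 : ℝ) ≤ (p : ℝ) ^ ε := by
        have h1 : (2 : ℝ) ^ (1 / ε) ≤ p := hP.trans (by exact_mod_cast not_lt.mp h)
        calc (2 : ℝ) = ((2 : ℝ) ^ (1 / ε)) ^ ε := by
              rw [← Real.rpow_mul (by norm_num), one_div_mul_cancel hε.ne', Real.rpow_one]
          _ ≤ _ := Real.rpow_le_rpow (by positivity) h1 hε.le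
      rw [one_mul]
      calc ((n.factorization p : ℝ) + 1) ≤ 2 ^ (n.factorization p) := by
            exact_mod_cast Nat.lt_two_pow_self
        _ ≤ _ := by gcongr
  calc ∏ p ∈ n.primeFactors, ((n.factorization p : ℝ) + 1)
      ≤ ∏ p ∈ n.primeFactors,
        ((if p < P then A else 1) * ((p : ℝ) ^ ε) ^ (n.factorization p)) :=
        Finset.prod_le_prod (fun _ _ => by positivity) hstep
    _ = (∏ p ∈ n.primeFactors, (if p < P then A else 1)) *
        ∏ p ∈ n.primeFactors, ((p : ℝ) ^ ε) ^ (n.factorization p) := Finset.prod_mul_distrib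
    _ ≤ _ := by
      gcongr
      rw [Finset.prod_ite, Finset.prod_const, Finset.prod_const_one, mul_one]
      refine pow_le_pow_right₀ hA1 ?_
      calc _ ≤ (Finset.range P).card := Finset.card_le_card (by
            intro p hp; simp at hp ⊢; exact hp.2)
        _ = P := by simp

/-- The binary cubic form with integer coefficients `a, b, c, d`, evaluated in a ring. -/
def cubicForm {R : Type*} [CommRing R] (a b c d : ℤ) (x y : R) : R :=
  a * x ^ 3 + b * x ^ 2 * y + c * x * y ^ 2 + d * y ^ 3

theorem map_cubicForm {R S : Type*} [CommRing R] [CommRing S] (f : R →+* S) (a b c d : ℤ)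
    (x y : R) : f (cubicForm a b c d x y) = cubicForm a b c d (f x) (f y) := by
  simp [cubicForm]

/-- A binary cubic form that is maximal at every prime. -/
structure IsMaximalForm (a b c d : ℤ) : Prop where
  primitive : ∀ p : ℕ, p.Prime →
    ¬ ((p : ℤ) ∣ a ∧ (p : ℤ) ∣ b ∧ (p : ℤ) ∣ c ∧ (p : ℤ) ∣ d)
  left : ∀ p : ℕ, p.Prime → ∀ t : ℤ,
    ¬ ((p : ℤ) ^ 2 ∣ a + b * t + c * t ^ 2 + d * t ^ 3 ∧ (p : ℤ) ∣ b + 2 * c * t + 3 * d * t ^ 2)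
  right : ∀ p : ℕ, p.Prime → ∀ t : ℤ,
    ¬ ((p : ℤ) ^ 2 ∣ d + c * t + b * t ^ 2 + a * t ^ 3 ∧ (p : ℤ) ∣ c + 2 * b * t + 3 * a * t ^ 2)

theorem IsMaximalForm.symm {a b c d : ℤ} (h : IsMaximalForm a b c d) : IsMaximalForm d c b a where
  primitive p hp := fun ⟨h1, h2, h3, h4⟩ => h.primitive p hp ⟨h4, h3, h2, h1⟩
  left := h.right
  right := h.left

theorem IsMaximalForm.modEq_of_root {a b c d : ℤ} (h : IsMaximalForm a b c d) {p e : ℕ}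
    (hp : p.Prime) {t u : ℤ}
    (ht : ((p ^ e : ℕ) : ℤ) ∣ a + b * t + c * t ^ 2 + d * t ^ 3)
    (hu : ((p ^ e : ℕ) : ℤ) ∣ a + b * u + c * u ^ 2 + d * u ^ 3)
    (htu : (p : ℤ) ∣ t - u) : ((p ^ e : ℕ) : ℤ) ∣ t - u := by
  push_cast at *
  have hpZ : Prime (p : ℤ) := Nat.prime_iff_prime_int.mp hp
  rcases Nat.lt_or_ge e 2 with he | he
  · exact (pow_dvd_pow (p : ℤ) (show e ≤ 1 by omega)).trans (by simpa using htu)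
  · have h1 : ¬ (p : ℤ) ∣ b + 2 * c * u + 3 * d * u ^ 2 := fun hd =>
      h.left p hp u ⟨(pow_dvd_pow _ he).trans hu, hd⟩
    set q := b + c * (t + u) + d * (t ^ 2 + t * u + u ^ 2) with hq
    have h2 : ¬ (p : ℤ) ∣ q := by
      intro hd
      apply h1
      have : b + 2 * c * u + 3 * d * u ^ 2 = q - (t - u) * (c + d * (t + 2 * u)) := by
        rw [hq]; ring
      rw [this]
      exact dvd_sub hd (htu.mul_right _)
    have h3 : (p : ℤ) ^ e ∣ q * (t - u) := by
      have : q * (t - u) = (a + b * t + c * t ^ 2 + d * t ^ 3) -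
          (a + b * u + c * u ^ 2 + d * u ^ 3) := by rw [hq]; ring
      rw [this]
      exact dvd_sub ht hu
    exact ((hpZ.coprime_iff_not_dvd.mpr h2).pow_left).dvd_of_dvd_mul_left h3

theorem IsMaximalForm.card_roots_le {a b c d : ℤ} (h : IsMaximalForm a b c d) {p e : ℕ}
    (hp : p.Prime) (he : e ≠ 0) :
    Nat.card {t : ZMod (p ^ e) // cubicForm a b c d 1 t = 0} ≤ 3 := by
  have : Fact p.Prime := ⟨hp⟩
  let P : Cubic (ZMod p) := ⟨d, c, b, a⟩
  have hP : P.toPoly ≠ 0 := by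
    intro h0
    have h1 := (Cubic.toPoly_eq_zero_iff P).mp h0
    have e1 : ((d : ℤ) : ZMod p) = 0 := congrArg Cubic.a h1
    have e2 : ((c : ℤ) : ZMod p) = 0 := congrArg Cubic.b h1
    have e3 : ((b : ℤ) : ZMod p) = 0 := congrArg Cubic.c h1
    have e4 : ((a : ℤ) : ZMod p) = 0 := congrArg Cubic.d h1
    rw [ZMod.intCast_zmod_eq_zero_iff_dvd] at e1 e2 e3 e4
    exact h.primitive p hp ⟨e4, e3, e2, e1⟩
  let π : ZMod (p ^ e) →+* ZMod p := ZMod.castHom (dvd_pow_self p he) (ZMod p)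
  have hroot : ∀ t : {t : ZMod (p ^ e) // cubicForm a b c d 1 t = 0},
      π t.1 ∈ P.toPoly.roots.toFinset := by
    intro t
    rw [Multiset.mem_toFinset, Polynomial.mem_roots hP, Polynomial.IsRoot.def]
    have := congrArg π t.2
    rw [map_cubicForm, map_one, map_zero] at this
    simp only [cubicForm] at this
    simp only [Cubic.toPoly, P, Polynomial.eval_add, Polynomial.eval_mul, Polynomial.eval_C,
      Polynomial.eval_pow, Polynomial.eval_X]
    linear_combination this
  have hinj : Function.Injective
      (fun t : {t : ZMod (p ^ e) // cubicForm a b c d 1 t = 0} =>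
        (⟨π t.1, hroot t⟩ : P.toPoly.roots.toFinset)) := by
    rintro ⟨t, ht⟩ ⟨u, hu⟩ htu
    simp only [Subtype.mk.injEq] at htu ⊢
    obtain ⟨t, rfl⟩ := ZMod.intCast_surjective t
    obtain ⟨u, rfl⟩ := ZMod.intCast_surjective u
    rw [map_intCast, map_intCast, ZMod.intCast_eq_intCast_iff_dvd_sub] at htu
    rw [ZMod.intCast_eq_intCast_iff_dvd_sub]
    have aux : ∀ v : ℤ, cubicForm a b c d 1 (v : ZMod (p ^ e)) = 0 →
        ((p ^ e : ℕ) : ℤ) ∣ a + b * v + c * v ^ 2 + d * v ^ 3 := by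
      intro v hv
      rw [← ZMod.intCast_zmod_eq_zero_iff_dvd]
      rw [← hv]
      simp [cubicForm]
    exact h.modEq_of_root hp (aux u hu) (aux t ht) htu
  have h1 := Nat.card_le_card_of_injective _ hinj
  refine h1.trans ?_
  rw [Nat.card_eq_fintype_card, Fintype.card_coe]
  refine (Multiset.toFinset_card_le _).trans ((Polynomial.card_roots' _).trans ?_)
  exact Polynomial.natDegree_cubic_le

/-- The unimodular zeros modulo `m` of a binary cubic form. -/
abbrev UnimodularZero (a b c d : ℤ) (m : ℕ) : Type :=
  {v : ZMod m × ZMod m // IsCoprime v.1 v.2 ∧ cubicForm a b c d v.1 v.2 = 0}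

theorem ZMod.isUnit_or_isUnit_of_isCoprime {p e : ℕ} (hp : p.Prime) (he : e ≠ 0)
    {x y : ZMod (p ^ e)} (h : IsCoprime x y) : IsUnit x ∨ IsUnit y := by
  have : Fact p.Prime := ⟨hp⟩
  have key : ∀ z : ZMod (p ^ e), ZMod.castHom (dvd_pow_self p he) (ZMod p) z ≠ 0 → IsUnit z := by
    intro z hz
    obtain ⟨z, rfl⟩ := ZMod.intCast_surjective z
    rw [map_intCast, Ne, ZMod.intCast_zmod_eq_zero_iff_dvd] at hz
    have hpZ : Prime (p : ℤ) := Nat.prime_iff_prime_int.mp hp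
    have := ((hpZ.coprime_iff_not_dvd.mpr hz).pow_left (m := e))
    have h2 := this.map (Int.castRingHom (ZMod (p ^ e)))
    simp only [map_pow, eq_intCast, Int.cast_natCast] at h2
    rw [← Nat.cast_pow, ZMod.natCast_self, isCoprime_zero_left] at h2
    exact h2
  have h' := h.map (ZMod.castHom (dvd_pow_self p he) (ZMod p))
  rcases h'.ne_zero_or_ne_zero with h1 | h1
  · exact Or.inl (key _ h1)
  · exact Or.inr (key _ h1)

theorem IsMaximalForm.card_unimodularZero_primePow_le {a b c d : ℤ} (h : IsMaximalForm a b c d)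
    {p e : ℕ} (hp : p.Prime) (he : e ≠ 0) :
    Nat.card (UnimodularZero a b c d (p ^ e)) ≤ 8 * p ^ e := by
  have : NeZero (p ^ e) := ⟨(pow_pos hp.pos e).ne'⟩
  let T := {t : ZMod (p ^ e) // cubicForm a b c d 1 t = 0}
  let T' := {t : ZMod (p ^ e) // cubicForm d c b a 1 t = 0}
  let f : (ZMod (p ^ e) × T) ⊕ (ZMod (p ^ e) × T') → ZMod (p ^ e) × ZMod (p ^ e) :=
    Sum.elim (fun z => (z.1, z.1 * z.2.1)) (fun z => (z.1 * z.2.1, z.1))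
  have hf : ∀ v : UnimodularZero a b c d (p ^ e), ∃ z, f z = v.1 := by
    rintro ⟨⟨x, y⟩, hxy, h0⟩
    simp only at hxy h0
    rcases ZMod.isUnit_or_isUnit_of_isCoprime hp he hxy with hx | hx
    · obtain ⟨w, hw⟩ := hx.exists_right_inv
      refine ⟨Sum.inl (x, ⟨w * y, ?_⟩), ?_⟩
      · simp only [cubicForm] at h0 ⊢
        linear_combination w ^ 3 * h0 -
          (a * (1 + w * x + w ^ 2 * x ^ 2) + b * w * y * (1 + w * x) + c * w ^ 2 * y ^ 2) * hw
      · simp only [f, Sum.elim_inl, Prod.mk.injEq, true_and]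
        linear_combination y * hw
    · obtain ⟨w, hw⟩ := hx.exists_right_inv
      refine ⟨Sum.inr (y, ⟨w * x, ?_⟩), ?_⟩
      · simp only [cubicForm] at h0 ⊢
        linear_combination w ^ 3 * h0 -
          (d * (1 + w * y + w ^ 2 * y ^ 2) + c * w * x * (1 + w * y) + b * w ^ 2 * x ^ 2) * hw
      · simp only [f, Sum.elim_inr, Prod.mk.injEq, and_true]
        linear_combination x * hw
  choose g hg using hf
  have hginj : Function.Injective g := fun v w hvw => by
    apply Subtype.ext
    rw [← hg v, ← hg w, hvw]
  have h1 := Nat.card_le_card_of_injective g hginj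
  rw [Nat.card_sum, Nat.card_prod, Nat.card_prod, Nat.card_zmod] at h1
  have h2 : Nat.card T ≤ 3 := h.card_roots_le hp he
  have h3 : Nat.card T' ≤ 3 := h.symm.card_roots_le hp he
  nlinarith [Nat.zero_le (p ^ e)]

theorem IsMaximalForm.card_unimodularZero_le {a b c d : ℤ} (h : IsMaximalForm a b c d)
    {m : ℕ} (hm : 0 < m) :
    Nat.card (UnimodularZero a b c d m) ≤ 8 ^ m.primeFactors.card * m := by
  induction m using Nat.recOnPosPrimePosCoprime with
  | zero => omega
  | one =>
    simp only [Nat.primeFactors_one, Finset.card_empty, pow_zero, mul_one]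
    have : Subsingleton (UnimodularZero a b c d 1) := by
      constructor
      rintro ⟨v, -⟩ ⟨w, -⟩
      exact Subtype.ext (Subsingleton.elim _ _)
    exact Finite.card_le_one_iff_subsingleton.mpr this
  | prime_pow p e hp he =>
    rw [Nat.primeFactors_prime_pow he.ne' hp, Finset.card_singleton, pow_one]
    exact h.card_unimodularZero_primePow_le hp he.ne'
  | coprime m n hm1 hn1 hmn ihm ihn =>
    have hm0 : 0 < m := by omega
    have hn0 : 0 < n := by omega
    have : NeZero m := ⟨hm0.ne'⟩
    have : NeZero n := ⟨hn0.ne'⟩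
    let π₁ : ZMod (m * n) →+* ZMod m := ZMod.castHom (dvd_mul_right m n) (ZMod m)
    let π₂ : ZMod (m * n) →+* ZMod n := ZMod.castHom (dvd_mul_left n m) (ZMod n)
    have hπ : ∀ x y : ZMod (m * n), π₁ x = π₁ y → π₂ x = π₂ y → x = y := by
      intro x y h1 h2
      obtain ⟨x, rfl⟩ := ZMod.intCast_surjective x
      obtain ⟨y, rfl⟩ := ZMod.intCast_surjective y
      rw [map_intCast, map_intCast, ZMod.intCast_eq_intCast_iff_dvd_sub] at h1 h2
      rw [ZMod.intCast_eq_intCast_iff_dvd_sub]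
      push_cast
      exact IsCoprime.mul_dvd (Nat.isCoprime_iff_coprime.mpr hmn) h1 h2
    have hz : ∀ (k : ℕ) (π : ZMod (m * n) →+* ZMod k) (v : UnimodularZero a b c d (m * n)),
        IsCoprime (π v.1.1) (π v.1.2) ∧ cubicForm a b c d (π v.1.1) (π v.1.2) = 0 :=
      fun k π v => ⟨v.2.1.map π, by rw [← map_cubicForm, v.2.2, map_zero]⟩
    let F : UnimodularZero a b c d (m * n) → UnimodularZero a b c d m × UnimodularZero a b c d n :=
      fun v => (⟨(π₁ v.1.1, π₁ v.1.2), hz m π₁ v⟩, ⟨(π₂ v.1.1, π₂ v.1.2), hz n π₂ v⟩)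
    have hF : Function.Injective F := by
      intro v w hvw
      simp only [F, Prod.mk.injEq, Subtype.mk.injEq] at hvw
      exact Subtype.ext (Prod.ext (hπ _ _ hvw.1.1 hvw.2.1) (hπ _ _ hvw.1.2 hvw.2.2))
    have h1 := Nat.card_le_card_of_injective F hF
    rw [Nat.card_prod] at h1
    rw [hmn.primeFactors_mul, Finset.card_union_of_disjoint hmn.disjoint_primeFactors, pow_add]
    calc _ ≤ _ := h1
      _ ≤ (8 ^ m.primeFactors.card * m) * (8 ^ n.primeFactors.card * n) :=
        Nat.mul_le_mul (ihm hm0) (ihn hn0)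
      _ = _ := by ring

theorem index_range_prodLinear (x₁ x₂ y₁ y₂ : ℤ) (h : x₁ * y₂ - x₂ * y₁ ≠ 0) :
    ∃ N : AddSubgroup (ℤ × ℤ), (∀ w, w ∈ N ↔
      ∃ k l : ℤ, w = (k * x₁ + l * x₂, k * y₁ + l * y₂)) ∧
      N.index = (x₁ * y₂ - x₂ * y₁).natAbs := by
  let b := Module.Basis.finTwoProd ℤ
  let A : (ℤ × ℤ) →ₗ[ℤ] (ℤ × ℤ) := Matrix.toLin b b !![x₁, x₂; y₁, y₂]
  have hA : ∀ v, A v = (v.1 * x₁ + v.2 * x₂, v.1 * y₁ + v.2 * y₂) := by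
    intro v
    simp only [A, b, Matrix.toLin_finTwoProd_apply]
    ext <;> simp <;> ring
  have hdet : LinearMap.det A = x₁ * y₂ - x₂ * y₁ := by
    simp only [A, LinearMap.det_toLin, Matrix.det_fin_two_of]
  have hinj : Function.Injective A := by
    rw [← LinearMap.ker_eq_bot]
    by_contra hk
    exact (hdet ▸ h) (LinearMap.det_eq_zero_iff_ker_ne_bot.mpr hk)
  refine ⟨(LinearMap.range A).toAddSubgroup, ?_, ?_⟩
  · intro w
    constructor
    · rintro ⟨v, rfl⟩
      exact ⟨v.1, v.2, hA v⟩
    · rintro ⟨k, l, rfl⟩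
      exact ⟨(k, l), hA _⟩
  · have h1 : (LinearMap.det A).natAbs = Nat.card ((ℤ × ℤ) ⧸ LinearMap.range A) :=
      Submodule.natAbs_det_equiv (LinearMap.range A) (LinearEquiv.ofInjective A hinj)
    rw [hdet] at h1
    exact h1.symm

theorem AddSubgroup.index_dvd_det {L : AddSubgroup (ℤ × ℤ)} {v w : ℤ × ℤ} (hv : v ∈ L)
    (hw : w ∈ L) : (L.index : ℤ) ∣ v.1 * w.2 - w.1 * v.2 := by
  by_cases h : v.1 * w.2 - w.1 * v.2 = 0
  · rw [h]; exact dvd_zero _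
  · obtain ⟨N, hN, hi⟩ := index_range_prodLinear v.1 w.1 v.2 w.2 h
    have hle : N ≤ L := by
      intro z hz
      obtain ⟨k, l, rfl⟩ := (hN z).mp hz
      rw [show (k * v.1 + l * w.1, k * v.2 + l * w.2) = k • v + l • w by ext <;> simp]
      exact L.add_mem (L.zsmul_mem hv k) (L.zsmul_mem hw l)
    have := AddSubgroup.index_dvd_of_le hle
    rw [hi] at this
    exact Int.natCast_dvd.mpr this

/-- Sublattices of `ℤ²` of index `s`, contained in no `pℤ²`, on which the form is divisible
by `m`. -/
abbrev PrimitiveSublattice (a b c d : ℤ) (s m : ℕ) : Type :=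
  {L : AddSubgroup (ℤ × ℤ) // L.index = s ∧
    (∀ p : ℕ, p.Prime → ∃ v ∈ L, ¬ ((p : ℤ) ∣ v.1 ∧ (p : ℤ) ∣ v.2)) ∧
    ∀ v ∈ L, (m : ℤ) ∣ cubicForm a b c d v.1 v.2}

theorem AddSubgroup.exists_mem_unimodular {L : AddSubgroup (ℤ × ℤ)}
    (h : ∀ p : ℕ, p.Prime → ∃ v ∈ L, ¬ ((p : ℤ) ∣ v.1 ∧ (p : ℤ) ∣ v.2)) {s : ℕ} (hs : 0 < s) :
    ∃ v ∈ L, IsCoprime (v.1 : ZMod s) (v.2 : ZMod s) := by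
  choose! u hu hu' using h
  let S := s.primeFactors
  let v : ℤ × ℤ := ∑ p ∈ S, (∏ q ∈ S.erase p, (q : ℤ)) • u p
  have hvL : v ∈ L := L.sum_mem fun p hp =>
    L.zsmul_mem (hu p (Nat.prime_of_mem_primeFactors hp)) _
  have hmod : ∀ p ∈ S, ∀ φ : ℤ × ℤ →+ ℤ, (p : ℤ) ∣ φ v → (p : ℤ) ∣ φ (u p) := by
    intro p hp φ hd
    have hpp := Nat.prime_of_mem_primeFactors hp
    have hpZ : Prime (p : ℤ) := Nat.prime_iff_prime_int.mp hpp
    have h1 : φ v = (∏ q ∈ S.erase p, (q : ℤ)) * φ (u p) +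
        ∑ r ∈ S.erase p, (∏ q ∈ S.erase r, (q : ℤ)) * φ (u r) := by
      simp only [v, map_sum, map_zsmul, smul_eq_mul]
      exact (Finset.add_sum_erase S _ hp).symm
    have h2 : (p : ℤ) ∣ ∑ r ∈ S.erase p, (∏ q ∈ S.erase r, (q : ℤ)) * φ (u r) := by
      refine Finset.dvd_sum fun r hr => Dvd.dvd.mul_right ?_ _
      exact Finset.dvd_prod_of_mem _ (Finset.mem_erase.mpr ⟨(Finset.ne_of_mem_erase hr).symm, hp⟩)
    rw [h1] at hd
    have h3 := (dvd_add_left h2).mp hd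
    rcases hpZ.dvd_or_dvd h3 with h4 | h4
    · obtain ⟨q, hq, hq'⟩ := (hpZ.dvd_finsetProd_iff _).mp h4
      have hqp := Nat.prime_of_mem_primeFactors (Finset.mem_of_mem_erase hq)
      have := (Nat.prime_dvd_prime_iff_eq hpp hqp).mp (Int.natCast_dvd_natCast.mp hq')
      exact absurd this.symm (Finset.ne_of_mem_erase hq)
    · exact h4
  refine ⟨v, hvL, ?_⟩
  have hg : IsCoprime ((Int.gcd v.1 v.2 : ℕ) : ℤ) (s : ℤ) := by
    rw [Nat.isCoprime_iff_coprime, Nat.coprime_iff_isRelPrime]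
    by_contra hc
    rw [← Nat.coprime_iff_isRelPrime] at hc
    obtain ⟨p, hp, hp1, hp2⟩ := Nat.Prime.not_coprime_iff_dvd.mp hc
    have hpS : p ∈ S := Nat.mem_primeFactors.mpr ⟨hp, hp2, hs.ne'⟩
    have h1 : (p : ℤ) ∣ v.1 := (Int.natCast_dvd_natCast.mpr hp1).trans (Int.gcd_dvd_left ..)
    have h2 : (p : ℤ) ∣ v.2 := (Int.natCast_dvd_natCast.mpr hp1).trans (Int.gcd_dvd_right ..)
    exact hu' p hp ⟨hmod p hpS (AddMonoidHom.fst ℤ ℤ) h1, hmod p hpS (AddMonoidHom.snd ℤ ℤ) h2⟩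
  obtain ⟨α, β, hαβ⟩ := hg
  have hb := Int.gcd_eq_gcd_ab v.1 v.2
  rw [hb] at hαβ
  refine ⟨(α * Int.gcdA v.1 v.2 : ℤ), (α * Int.gcdB v.1 v.2 : ℤ), ?_⟩
  have := congrArg (Int.cast : ℤ → ZMod s) hαβ
  push_cast at this ⊢
  rw [ZMod.natCast_self, mul_zero, add_zero] at this
  linear_combination this

theorem AddSubgroup.mem_iff_det_eq_zero {L : AddSubgroup (ℤ × ℤ)} {s : ℕ} (hL : L.index = s)
    {v : ℤ × ℤ} (hv : v ∈ L) (hc : IsCoprime (v.1 : ZMod s) (v.2 : ZMod s)) (w : ℤ × ℤ) :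
    w ∈ L ↔ (v.1 : ZMod s) * w.2 - w.1 * v.2 = 0 := by
  constructor
  · intro hw
    have h := AddSubgroup.index_dvd_det hv hw
    rw [hL, ← ZMod.intCast_zmod_eq_zero_iff_dvd] at h
    simpa using h
  · intro h
    obtain ⟨α, β, hαβ⟩ := hc
    obtain ⟨α, rfl⟩ := ZMod.intCast_surjective α
    obtain ⟨β, rfl⟩ := ZMod.intCast_surjective β
    have h1 : (s : ℤ) ∣ w.1 - (α * w.1 + β * w.2) * v.1 := by
      rw [← ZMod.intCast_zmod_eq_zero_iff_dvd]
      push_cast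
      linear_combination (-(w.1 : ZMod s)) * hαβ - β * h
    have h2 : (s : ℤ) ∣ w.2 - (α * w.1 + β * w.2) * v.2 := by
      rw [← ZMod.intCast_zmod_eq_zero_iff_dvd]
      push_cast
      linear_combination (-(w.2 : ZMod s)) * hαβ + α * h
    obtain ⟨k, hk⟩ := h1
    obtain ⟨l, hl⟩ := h2
    have h3 : s • ((k, l) : ℤ × ℤ) ∈ L := by
      rw [← hL]; exact L.nsmul_index_mem _
    have h4 : w = (α * w.1 + β * w.2) • v + s • ((k, l) : ℤ × ℤ) := by
      ext
      · simp; linear_combination hk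
      · simp; linear_combination hl
    rw [h4]
    exact L.add_mem (L.zsmul_mem hv _) h3

theorem card_unimodular_lift_le (a b c d : ℤ) {s m : ℕ} (hs : 0 < s) (hm : m ∣ s) :
    Nat.card {w : ZMod s × ZMod s // IsCoprime w.1 w.2 ∧
      cubicForm a b c d (ZMod.castHom hm (ZMod m) w.1) (ZMod.castHom hm (ZMod m) w.2) = 0} ≤
      (s / m) ^ 2 * Nat.card (UnimodularZero a b c d m) := by
  have : NeZero s := ⟨hs.ne'⟩
  have hm0 : 0 < m := Nat.pos_of_dvd_of_pos hm hs
  have : NeZero m := ⟨hm0.ne'⟩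
  let π := ZMod.castHom hm (ZMod m)
  have hlt : ∀ x : ZMod s, x.val / m < s / m := fun x =>
    Nat.div_lt_div_of_lt_of_dvd hm (ZMod.val_lt x)
  let W := {w : ZMod s × ZMod s // IsCoprime w.1 w.2 ∧ cubicForm a b c d (π w.1) (π w.2) = 0}
  let F : W → (Fin (s / m) × Fin (s / m)) × UnimodularZero a b c d m := fun w =>
    ((⟨_, hlt w.1.1⟩, ⟨_, hlt w.1.2⟩), ⟨(π w.1.1, π w.1.2), w.2.1.map π, w.2.2⟩)
  have haux : ∀ x y : ZMod s, x.val / m = y.val / m → π x = π y → x = y := by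
    intro x y h1 h2
    apply ZMod.val_injective s
    rw [← ZMod.natCast_zmod_val x, ← ZMod.natCast_zmod_val y, map_natCast, map_natCast,
      ZMod.natCast_eq_natCast_iff'] at h2
    rw [← Nat.div_add_mod x.val m, ← Nat.div_add_mod y.val m, h1, h2]
  have hF : Function.Injective F := by
    intro v w hvw
    simp only [F, Prod.mk.injEq, Subtype.mk.injEq, Fin.mk.injEq] at hvw
    exact Subtype.ext (Prod.ext (haux _ _ hvw.1.1 hvw.2.1) (haux _ _ hvw.1.2 hvw.2.2))
  have h1 := Nat.card_le_card_of_injective F hF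
  rw [Nat.card_prod, Nat.card_prod, Nat.card_fin, ← sq] at h1
  exact h1

theorem Nat.le_two_pow_mul_totient (s : ℕ) : s ≤ 2 ^ s.primeFactors.card * s.totient := by
  have h1 := Nat.totient_mul_prod_primeFactors s
  have h2 : ∏ p ∈ s.primeFactors, p ≤ 2 ^ s.primeFactors.card * ∏ p ∈ s.primeFactors, (p - 1) := by
    rw [← Finset.prod_const, ← Finset.prod_mul_distrib]
    refine Finset.prod_le_prod' fun p hp => ?_
    have := (Nat.prime_of_mem_primeFactors hp).two_le
    omega
  have h3 : 0 < ∏ p ∈ s.primeFactors, (p - 1) := Finset.prod_pos fun p hp => by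
    have := (Nat.prime_of_mem_primeFactors hp).two_le
    omega
  refine Nat.le_of_mul_le_mul_right ?_ h3
  rw [← h1]
  calc _ ≤ s.totient * (2 ^ s.primeFactors.card * ∏ p ∈ s.primeFactors, (p - 1)) :=
        Nat.mul_le_mul_left _ h2
    _ = _ := by ring

theorem IsMaximalForm.card_primitiveSublattice_le {a b c d : ℤ} (h : IsMaximalForm a b c d)
    {s m : ℕ} (hs : 0 < s) (hm : m ∣ s) :
    Finite (PrimitiveSublattice a b c d s m) ∧
    Nat.card (PrimitiveSublattice a b c d s m) ≤ 16 ^ s.primeFactors.card * (s / m) := by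
  have : NeZero s := ⟨hs.ne'⟩
  have hm0 : 0 < m := Nat.pos_of_dvd_of_pos hm hs
  let π := ZMod.castHom hm (ZMod m)
  let W := {w : ZMod s × ZMod s // IsCoprime w.1 w.2 ∧ cubicForm a b c d (π w.1) (π w.2) = 0}
  have hex : ∀ L : PrimitiveSublattice a b c d s m,
      ∃ v ∈ L.1, IsCoprime (v.1 : ZMod s) (v.2 : ZMod s) :=
    fun L => AddSubgroup.exists_mem_unimodular L.2.2.1 hs
  choose v hvL hvc using hex
  have hW : ∀ (L : PrimitiveSublattice a b c d s m) (u : (ZMod s)ˣ),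
      IsCoprime (u * (v L).1 : ZMod s) (u * (v L).2 : ZMod s) ∧
      cubicForm a b c d (π (u * (v L).1)) (π (u * (v L).2)) = 0 := by
    intro L u
    refine ⟨(isCoprime_mul_unit_left u.isUnit _ _).mpr (hvc L), ?_⟩
    have h1 := L.2.2.2 _ (hvL L)
    rw [← ZMod.intCast_zmod_eq_zero_iff_dvd] at h1
    have h2 : cubicForm a b c d (((v L).1 : ℤ) : ZMod m) (((v L).2 : ℤ) : ZMod m) = 0 := by
      rw [← h1]; simp [cubicForm]
    rw [map_mul, map_mul, map_intCast, map_intCast]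
    simp only [cubicForm] at h2 ⊢
    linear_combination (π u) ^ 3 * h2
  let F : PrimitiveSublattice a b c d s m × (ZMod s)ˣ → W := fun z => ⟨(_, _), hW z.1 z.2⟩
  have hF : Function.Injective F := by
    rintro ⟨L, u⟩ ⟨L', u'⟩ hLL
    have e1 : (u * (v L).1 : ZMod s) = u' * (v L').1 := congrArg (fun w : W => w.1.1) hLL
    have e2 : (u * (v L).2 : ZMod s) = u' * (v L').2 := congrArg (fun w : W => w.1.2) hLL
    have key : ∀ w, w ∈ L.1 ↔ w ∈ L'.1 := by
      intro w
      rw [AddSubgroup.mem_iff_det_eq_zero L.2.1 (hvL L) (hvc L),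
        AddSubgroup.mem_iff_det_eq_zero L'.2.1 (hvL L') (hvc L')]
      rw [← u.isUnit.mul_right_eq_zero, ← u'.isUnit.mul_right_eq_zero (b := _ - _)]
      rw [show (u : ZMod s) * ((v L).1 * w.2 - w.1 * (v L).2) =
        (u' : ZMod s) * ((v L').1 * w.2 - w.1 * (v L').2) by
          linear_combination (w.2 : ZMod s) * e1 - w.1 * e2]
    have hL : L = L' := Subtype.ext (AddSubgroup.ext key)
    subst hL
    obtain ⟨α, β, hαβ⟩ := hvc L
    have : u = u' := Units.ext (by linear_combination α * e1 + β * e2 + (u' - u : ZMod s) * hαβ)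
    rw [this]
  have hfin : Finite (PrimitiveSublattice a b c d s m) := by
    have : Function.Injective fun L : PrimitiveSublattice a b c d s m => F (L, 1) :=
      fun L L' h => congrArg Prod.fst (hF h)
    exact Finite.of_injective _ this
  refine ⟨hfin, ?_⟩
  have h1 := Nat.card_le_card_of_injective F hF
  rw [Nat.card_prod, Nat.card_eq_fintype_card (α := (ZMod s)ˣ), ZMod.card_units_eq_totient] at h1
  have h2 := h1.trans (card_unimodular_lift_le a b c d hs hm)
  have h3 := h.card_unimodularZero_le hm0
  have h4 := Nat.le_two_pow_mul_totient s
  have h5 : 8 ^ m.primeFactors.card ≤ 8 ^ s.primeFactors.card :=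
    Nat.pow_le_pow_right (by norm_num)
      (Finset.card_le_card (Nat.primeFactors_mono hm hs.ne'))
  refine Nat.le_of_mul_le_mul_right ?_ (Nat.totient_pos.mpr hs)
  calc _ ≤ (s / m) ^ 2 * Nat.card (UnimodularZero a b c d m) := h2
    _ ≤ (s / m) ^ 2 * (8 ^ s.primeFactors.card * m) :=
      Nat.mul_le_mul_left _ (h3.trans (Nat.mul_le_mul_right _ h5))
    _ = (s / m) * 8 ^ s.primeFactors.card * (s / m * m) := by ring
    _ = (s / m) * 8 ^ s.primeFactors.card * s := by rw [Nat.div_mul_cancel hm]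
    _ ≤ (s / m) * 8 ^ s.primeFactors.card * (2 ^ s.primeFactors.card * s.totient) :=
      Nat.mul_le_mul_left _ h4
    _ = _ := by rw [show (16 : ℕ) = 8 * 2 by norm_num, mul_pow]; ring

/-- Multiplication by `j` on `ℤ²`. -/
def scaleHom (j : ℕ) : ℤ × ℤ →+ ℤ × ℤ := nsmulAddMonoidHom j

theorem scaleHom_apply (j : ℕ) (v : ℤ × ℤ) : scaleHom j v = (j * v.1, j * v.2) := by
  simp [scaleHom, nsmulAddMonoidHom]
  ext <;> simp

theorem index_range_scaleHom {j : ℕ} (hj : 0 < j) : (scaleHom j).range.index = j ^ 2 := by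
  have hne : (j : ℤ) * j - 0 * 0 ≠ 0 := by
    simp [hj.ne']
  obtain ⟨N, hN, hi⟩ := index_range_prodLinear j 0 0 j hne
  have : (scaleHom j).range = N := by
    ext w
    rw [hN]
    constructor
    · rintro ⟨v, rfl⟩
      exact ⟨v.1, v.2, by rw [scaleHom_apply]; ext <;> simp [mul_comm]⟩
    · rintro ⟨k, l, rfl⟩
      exact ⟨(k, l), by rw [scaleHom_apply]; ext <;> simp [mul_comm]⟩
  rw [this, hi, mul_zero, sub_zero, Int.natAbs_mul, Int.natAbs_natCast, sq]

/-- A sublattice of `ℤ²` of finite index is a multiple of one contained in no `pℤ²`. -/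
theorem AddSubgroup.exists_eq_map_scaleHom {L : AddSubgroup (ℤ × ℤ)} {n : ℕ} (hn : 0 < n)
    (hL : L.index = n) : ∃ j : ℕ, 0 < j ∧ ∃ M : AddSubgroup (ℤ × ℤ), L = M.map (scaleHom j) ∧
      n = M.index * j ^ 2 ∧
      ∀ p : ℕ, p.Prime → ∃ v ∈ M, ¬ ((p : ℤ) ∣ v.1 ∧ (p : ℤ) ∣ v.2) := by
  let P : ℕ → Prop := fun j => ∀ v ∈ L, (j : ℤ) ∣ v.1 ∧ (j : ℤ) ∣ v.2
  have hnL : (((n : ℤ), (0 : ℤ)) : ℤ × ℤ) ∈ L := by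
    have := L.nsmul_index_mem ((1 : ℤ), (0 : ℤ))
    rw [hL] at this
    simpa using this
  have hbd : ∀ j, P j → j ≤ n := fun j hj =>
    Nat.le_of_dvd hn (Int.natCast_dvd_natCast.mp (hj _ hnL).1)
  have hP1 : P 1 := fun v _ => by simp
  let j := Nat.findGreatest P n
  have hPj : P j := Nat.findGreatest_spec (m := 1) hn hP1
  have hj1 : 1 ≤ j := Nat.le_findGreatest hn hP1
  let M := L.comap (scaleHom j)
  have hLM : L = M.map (scaleHom j) := by
    ext v
    constructor
    · intro hv
      obtain ⟨⟨x, hx⟩, ⟨y, hy⟩⟩ := hPj v hv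
      have e : scaleHom j (x, y) = v := by rw [scaleHom_apply]; ext <;> simp [hx, hy]
      exact ⟨(x, y), by rw [SetLike.mem_coe, AddSubgroup.mem_comap, e]; exact hv, e⟩
    · rintro ⟨w, hw, rfl⟩
      exact hw
  have hinj : Function.Injective (scaleHom j) := by
    intro v w hvw
    have hj0 : (j : ℤ) ≠ 0 := by positivity
    rw [scaleHom_apply, scaleHom_apply, Prod.mk.injEq] at hvw
    exact Prod.ext (mul_left_cancel₀ hj0 hvw.1) (mul_left_cancel₀ hj0 hvw.2)
  refine ⟨j, hj1, M, hLM, ?_, ?_⟩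
  · rw [← hL, hLM, AddSubgroup.index_map_of_injective _ hinj, index_range_scaleHom hj1]
  · intro p hp
    by_contra! hc
    have : P (j * p) := by
      intro v hv
      rw [hLM] at hv
      obtain ⟨w, hw, rfl⟩ := hv
      obtain ⟨h1, h2⟩ := hc w hw
      rw [scaleHom_apply]
      push_cast
      exact ⟨mul_dvd_mul_left _ h1, mul_dvd_mul_left _ h2⟩
    have h1 : j * p ≤ j := Nat.le_findGreatest (hbd _ this) this
    have := hp.two_le
    nlinarith

theorem two_pow_card_primeFactors_le {n : ℕ} (hn : n ≠ 0) :
    2 ^ n.primeFactors.card ≤ n.divisors.card := by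
  rw [Nat.card_divisors hn, ← Finset.prod_const]
  refine Finset.prod_le_prod' fun p hp => ?_
  have := (Nat.prime_of_mem_primeFactors hp).factorization_pos_of_dvd hn
    (Nat.dvd_of_mem_primeFactors hp)
  omega

theorem IsMaximalForm.card_sublattice_le {a b c d : ℤ} (h : IsMaximalForm a b c d) {n G : ℕ}
    (hn : 0 < n) (hG : ∀ g, g ^ 3 ∣ n → g ≤ G) :
    Finite {L : AddSubgroup (ℤ × ℤ) // L.index = n ∧
      ∀ v ∈ L, (n : ℤ) ∣ cubicForm a b c d v.1 v.2} ∧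
    Nat.card {L : AddSubgroup (ℤ × ℤ) // L.index = n ∧
      ∀ v ∈ L, (n : ℤ) ∣ cubicForm a b c d v.1 v.2} ≤ n.divisors.card ^ 5 * G := by
  let J := {j // j ∈ n.divisors.filter (fun j => j ^ 2 ∣ n)}
  have : Fintype J := inferInstanceAs (Fintype {j // j ∈ n.divisors.filter (fun j => j ^ 2 ∣ n)})
  let s : ℕ → ℕ := fun j => n / j ^ 2
  let m : ℕ → ℕ := fun j => s j / (s j).gcd j
  let T := {L : AddSubgroup (ℤ × ℤ) // L.index = n ∧
      ∀ v ∈ L, (n : ℤ) ∣ cubicForm a b c d v.1 v.2}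
  let Q := (j : J) × PrimitiveSublattice a b c d (s j.1) (m j.1)
  have hJ : ∀ j : J, 0 < j.1 ∧ j.1 ^ 2 * s j.1 = n ∧ 0 < s j.1 ∧ m j.1 ∣ s j.1 ∧
      s j.1 / m j.1 = (s j.1).gcd j.1 := by
    rintro ⟨j, hj⟩
    rw [Finset.mem_filter, Nat.mem_divisors] at hj
    have hj0 : 0 < j := Nat.pos_of_dvd_of_pos hj.1.1 hn
    have hs : 0 < n / j ^ 2 := Nat.div_pos (Nat.le_of_dvd hn hj.2) (by positivity)
    exact ⟨hj0, Nat.mul_div_cancel' hj.2, hs, Nat.div_dvd_of_dvd (Nat.gcd_dvd_left _ _),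
      Nat.div_div_self (Nat.gcd_dvd_left _ _) hs.ne'⟩
  let f : Q → AddSubgroup (ℤ × ℤ) := fun q => q.2.1.map (scaleHom q.1.1)
  have hf : ∀ L : T, ∃ q : Q, f q = L.1 := by
    rintro ⟨L, hL, hdiv⟩
    obtain ⟨j, hj, M, hLM, hnM, hM⟩ := AddSubgroup.exists_eq_map_scaleHom hn hL
    have hj2 : j ^ 2 ∣ n := ⟨M.index, by rw [hnM, mul_comm]⟩
    have hsj : M.index = s j := by
      simp only [s]
      rw [hnM, Nat.mul_div_cancel _ (by positivity)]
    have hjJ : j ∈ n.divisors.filter (fun j => j ^ 2 ∣ n) := by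
      rw [Finset.mem_filter, Nat.mem_divisors]
      exact ⟨⟨(dvd_pow_self j two_ne_zero).trans hj2, hn.ne'⟩, hj2⟩
    refine ⟨⟨⟨j, hjJ⟩, ⟨M, hsj, hM, ?_⟩⟩, hLM.symm⟩
    intro v hv
    have h1 := hdiv (scaleHom j v) (by rw [hLM]; exact ⟨v, hv, rfl⟩)
    have h2 : cubicForm a b c d (scaleHom j v).1 (scaleHom j v).2 =
        (j : ℤ) ^ 2 * (j * cubicForm a b c d v.1 v.2) := by
      rw [scaleHom_apply]; simp only [cubicForm]; ring
    rw [h2, show (n : ℤ) = (j : ℤ) ^ 2 * (s j : ℕ) by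
      rw [hnM, hsj]; push_cast; ring] at h1
    have h3 : ((s j : ℕ) : ℤ) ∣ j * cubicForm a b c d v.1 v.2 :=
      Int.dvd_of_mul_dvd_mul_left (by positivity) h1
    have h4 := (hJ ⟨j, hjJ⟩).2.2.1
    have hg : 0 < (s j).gcd j := Nat.gcd_pos_of_pos_left _ h4
    have h5 : ((m j : ℕ) : ℤ) ∣ ((j / (s j).gcd j : ℕ) : ℤ) * cubicForm a b c d v.1 v.2 := by
      have e1 : s j = (s j).gcd j * m j := (Nat.mul_div_cancel' (Nat.gcd_dvd_left _ _)).symm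
      have e2 : j = (s j).gcd j * (j / (s j).gcd j) :=
        (Nat.mul_div_cancel' (Nat.gcd_dvd_right _ _)).symm
      obtain ⟨k, hk⟩ := h3
      refine ⟨k, ?_⟩
      have e1' : (s j : ℤ) = ((s j).gcd j : ℤ) * (m j : ℤ) := by exact_mod_cast e1
      have e2' : (j : ℤ) = ((s j).gcd j : ℤ) * ((j / (s j).gcd j : ℕ) : ℤ) := by
        exact_mod_cast e2
      have hg' : ((s j).gcd j : ℤ) ≠ 0 := by exact_mod_cast hg.ne'
      apply mul_left_cancel₀ hg'
      linear_combination hk - cubicForm a b c d v.1 v.2 * e2' + k * e1'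
    exact (Nat.isCoprime_iff_coprime.mpr (Nat.coprime_div_gcd_div_gcd hg)).dvd_of_dvd_mul_left h5
  choose g hg using hf
  have hginj : Function.Injective g := fun L M hLM => by
    apply Subtype.ext
    rw [← hg L, ← hg M, hLM]
  have hfinP : ∀ j : J, Finite (PrimitiveSublattice a b c d (s j.1) (m j.1)) := fun j =>
    (h.card_primitiveSublattice_le (hJ j).2.2.1 (hJ j).2.2.2.1).1
  have hcard : ∀ j : J, Nat.card (PrimitiveSublattice a b c d (s j.1) (m j.1)) ≤
      n.divisors.card ^ 4 * G := by
    intro j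
    obtain ⟨hj0, hjs, hs0, hms, hsm⟩ := hJ j
    refine (h.card_primitiveSublattice_le hs0 hms).2.trans ?_
    have h1 : s j.1 / m j.1 ≤ G := by
      rw [hsm]
      apply hG
      refine dvd_trans ?_ hjs.dvd
      rw [pow_succ]
      exact mul_dvd_mul (pow_dvd_pow_of_dvd (Nat.gcd_dvd_right _ _) 2) (Nat.gcd_dvd_left _ _)
    have h2 : 16 ^ (s j.1).primeFactors.card ≤ n.divisors.card ^ 4 := by
      calc 16 ^ (s j.1).primeFactors.card ≤ 16 ^ n.primeFactors.card := by
            refine Nat.pow_le_pow_right (by norm_num) (Finset.card_le_card ?_)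
            exact Nat.primeFactors_mono ⟨j.1 ^ 2, by linarith⟩ hn.ne'
        _ = (2 ^ n.primeFactors.card) ^ 4 := by
          rw [← pow_mul, mul_comm, pow_mul]; norm_num
        _ ≤ _ := Nat.pow_le_pow_left (two_pow_card_primeFactors_le hn.ne') 4
    exact Nat.mul_le_mul h2 h1
  have hQ : Finite Q := inferInstanceAs (Finite (Σ j : J, _))
  refine ⟨Finite.of_injective g hginj, ?_⟩
  refine (Nat.card_le_card_of_injective g hginj).trans ?_
  rw [Nat.card_sigma]
  calc _ ≤ ∑ j : J, n.divisors.card ^ 4 * G := Finset.sum_le_sum fun j _ => hcard j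
    _ = Fintype.card J * (n.divisors.card ^ 4 * G) := by simp
    _ ≤ n.divisors.card * (n.divisors.card ^ 4 * G) := by
      refine Nat.mul_le_mul_right _ ?_
      rw [Fintype.card_of_subtype (n.divisors.filter (fun j => j ^ 2 ∣ n)) (fun _ => Iff.rfl)]
      exact Finset.card_filter_le _ _
    _ = _ := by ring

/-- `1, ω, θ` is a `ℤ`-basis of the ring `O`, normalized so that `ω * θ` is an integer, and
`a, b, c, d` are the coefficients of the corresponding index form. -/
structure IsCubicRingBasis {O : Type*} [CommRing O] (ω θ : O) (a b c d : ℤ) : Prop where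
  span : ∀ x : O, ∃ k l m : ℤ, x = k + l * ω + m * θ
  indep : ∀ k l m : ℤ, (k : O) + l * ω + m * θ = 0 → k = 0 ∧ l = 0 ∧ m = 0
  sq_left : ω ^ 2 = -(a * c) + b * ω - a * θ
  mul : ω * θ = -(a * d)
  sq_right : θ ^ 2 = -(b * d) + d * ω - c * θ

theorem exists_isCubicRingBasis {O : Type*} [CommRing O] {ω θ : O}
    (span : ∀ x : O, ∃ k l m : ℤ, x = k + l * ω + m * θ)
    (indep : ∀ k l m : ℤ, (k : O) + l * ω + m * θ = 0 → k = 0 ∧ l = 0 ∧ m = 0) :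
    ∃ r q a b c d : ℤ, IsCubicRingBasis (ω - r) (θ - q) a b c d := by
  obtain ⟨n₀, q, r, h⟩ := span (ω * θ)
  have span' : ∀ x : O, ∃ k l m : ℤ, x = k + l * (ω - r) + m * (θ - q) := by
    intro x
    obtain ⟨k, l, m, rfl⟩ := span x
    exact ⟨k + l * r + m * q, l, m, by push_cast; ring⟩
  have indep' : ∀ k l m : ℤ, (k : O) + l * (ω - r) + m * (θ - q) = 0 →
      k = 0 ∧ l = 0 ∧ m = 0 := by
    intro k l m hk
    obtain ⟨h1, h2, h3⟩ := indep (k - l * r - m * q) l m (by push_cast; linear_combination hk)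
    subst h2 h3
    exact ⟨by simpa using h1, rfl, rfl⟩
  refine ⟨r, q, ?_⟩
  have hmul : (ω - r) * (θ - q) = ((n₀ + r * q : ℤ) : O) := by
    push_cast; linear_combination h
  generalize n₀ + r * q = n at hmul
  generalize ω - (r : O) = ω' at *
  generalize θ - (q : O) = θ' at *
  obtain ⟨N, b, a, hω⟩ := span' (ω' ^ 2)
  obtain ⟨M, d, c, hθ⟩ := span' (θ' ^ 2)
  obtain ⟨-, e2, e3⟩ := indep' (b * n + a * M) (a * d - n) (N + a * c) (by
    push_cast
    linear_combination (-θ') * hω - (a : O) * hθ + (ω' - b) * hmul)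
  obtain ⟨-, e5, -⟩ := indep' (d * N + c * n) (M + d * b) (d * a - n) (by
    push_cast
    linear_combination (-ω') * hθ - (d : O) * hω + (θ' - c) * hmul)
  have e2' : n = a * d := by linarith
  have e3' : N = -(a * c) := by linarith
  have e5' : M = -(b * d) := by linarith
  refine ⟨-a, b, -c, d, span', indep', ?_, ?_, ?_⟩
  · rw [hω, e3']; push_cast; ring
  · rw [hmul, e2']; push_cast; ring
  · rw [hθ, e5']; push_cast; ring

namespace IsCubicRingBasis

variable {O : Type*} [CommRing O] {ω θ : O} {a b c d : ℤ}

theorem symm (h : IsCubicRingBasis ω θ a b c d) : IsCubicRingBasis (-θ) (-ω) d c b a where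
  span x := by
    obtain ⟨k, l, m, rfl⟩ := h.span x
    exact ⟨k, -m, -l, by push_cast; ring⟩
  indep k l m hk := by
    obtain ⟨h1, h2, h3⟩ := h.indep k (-m) (-l) (by push_cast; linear_combination hk)
    exact ⟨h1, by linarith, by linarith⟩
  sq_left := by linear_combination h.sq_right
  mul := by linear_combination h.mul
  sq_right := by linear_combination h.sq_left

theorem shear (h : IsCubicRingBasis ω θ a b c d) (t : ℤ) :
    IsCubicRingBasis (ω + t * θ + (t * c + t ^ 2 * d : ℤ)) (θ - (t * d : ℤ))
      (a + b * t + c * t ^ 2 + d * t ^ 3) (b + 2 * c * t + 3 * d * t ^ 2) (c + 3 * d * t) d where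
  span x := by
    obtain ⟨k, l, m, rfl⟩ := h.span x
    exact ⟨k - l * (t * c + t ^ 2 * d) + (m - l * t) * (t * d), l, m - l * t, by
      push_cast; ring⟩
  indep k l m hk := by
    obtain ⟨h1, h2, h3⟩ := h.indep (k + l * (t * c + t ^ 2 * d) - m * (t * d)) l (m + l * t) (by
      push_cast at hk ⊢; linear_combination hk)
    subst h2
    have h4 : m = 0 := by simpa using h3
    subst h4
    exact ⟨by simpa using h1, rfl, rfl⟩
  sq_left := by
    push_cast
    linear_combination h.sq_left + 2 * t * h.mul + t ^ 2 * h.sq_right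
  mul := by
    push_cast
    linear_combination h.mul + t * h.sq_right
  sq_right := by
    push_cast
    linear_combination h.sq_right

theorem charpoly_left (h : IsCubicRingBasis ω θ a b c d) :
    ω ^ 3 - b * ω ^ 2 + a * c * ω - a ^ 2 * d = 0 := by
  linear_combination ω * h.sq_left - a * h.mul

/-- Divisibility by `p` can be tested on the characteristic polynomial. -/
def IsClosedUnderDivision (O : Type*) [CommRing O] : Prop :=
  ∀ p : ℕ, p.Prime → ∀ (x : O) (A B D : ℤ),
    x ^ 3 - (p * B : ℤ) * x ^ 2 + (p ^ 2 * A : ℤ) * x - (p ^ 3 * D : ℤ) = 0 → (p : O) ∣ x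

theorem not_dvd (h : IsCubicRingBasis ω θ a b c d) (hO : IsClosedUnderDivision O) {p : ℕ}
    (hp : p.Prime) (hb : (p : ℤ) ∣ b) (hac : (p : ℤ) ^ 2 ∣ a * c) (had : (p : ℤ) ^ 3 ∣ a ^ 2 * d) :
    False := by
  obtain ⟨B, hB⟩ := hb
  obtain ⟨A, hA⟩ := hac
  obtain ⟨D, hD⟩ := had
  obtain ⟨z, hz⟩ := hO p hp ω A B D (by
    rw [← hB, ← hA, ← hD]; push_cast; linear_combination h.charpoly_left)
  obtain ⟨k, l, m, rfl⟩ := h.span z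
  obtain ⟨-, h2, -⟩ := h.indep (p * k) (p * l - 1) (p * m) (by
    push_cast; linear_combination -hz)
  have h3 : (p : ℤ) ∣ 1 := ⟨l, by linarith⟩
  have := Int.natCast_dvd_natCast.mp (by exact_mod_cast h3 : (p : ℤ) ∣ (1 : ℕ))
  exact hp.one_lt.ne' (Nat.dvd_one.mp this)

theorem not_left (h : IsCubicRingBasis ω θ a b c d) (hO : IsClosedUnderDivision O) {p : ℕ}
    (hp : p.Prime) (t : ℤ) :
    ¬ ((p : ℤ) ^ 2 ∣ a + b * t + c * t ^ 2 + d * t ^ 3 ∧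
      (p : ℤ) ∣ b + 2 * c * t + 3 * d * t ^ 2) := by
  rintro ⟨h1, h2⟩
  refine (h.shear t).not_dvd hO hp h2 (h1.mul_right _) (Dvd.dvd.mul_right ?_ _)
  refine (pow_dvd_pow (p : ℤ) (show 3 ≤ 2 * 2 by norm_num)).trans ?_
  rw [pow_mul]
  exact pow_dvd_pow_of_dvd h1 2

theorem isMaximalForm (h : IsCubicRingBasis ω θ a b c d) (hO : IsClosedUnderDivision O) :
    IsMaximalForm a b c d where
  primitive p hp := by
    rintro ⟨h1, h2, h3, h4⟩
    refine h.not_dvd hO hp h2 ?_ ?_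
    · rw [sq]; exact mul_dvd_mul h1 h3
    · rw [pow_succ]; exact mul_dvd_mul (pow_dvd_pow_of_dvd h1 2) h4
  left p hp t := h.not_left hO hp t
  right p hp t := h.symm.not_left hO hp t

/-- The coordinate map `(x, y) ↦ x ω + y θ`. -/
def coordHom (ω θ : O) : ℤ × ℤ →+ O :=
  ((AddMonoidHom.mulRight ω).comp (Int.castAddHom O)).coprod
    ((AddMonoidHom.mulRight θ).comp (Int.castAddHom O))

theorem coordHom_apply (ω θ : O) (v : ℤ × ℤ) : coordHom ω θ v = v.1 * ω + v.2 * θ := rfl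

theorem mem_iff_coord {R : Subring O} {k l m : ℤ} :
    (k : O) + l * ω + m * θ ∈ R ↔ (l, m) ∈ R.toAddSubgroup.comap (coordHom ω θ) := by
  rw [AddSubgroup.mem_comap, coordHom_apply, Subring.mem_toAddSubgroup, add_assoc]
  exact R.toAddSubgroup.add_mem_cancel_left (intCast_mem R k)

theorem index_comap_coordHom (h : IsCubicRingBasis ω θ a b c d) (R : Subring O) :
    (R.toAddSubgroup.comap (coordHom ω θ)).index = R.toAddSubgroup.index := by
  rw [AddSubgroup.index_comap, ← AddSubgroup.relIndex_sup_right]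
  have : (coordHom ω θ).range ⊔ R.toAddSubgroup = ⊤ := by
    rw [eq_top_iff]
    intro x _
    obtain ⟨k, l, m, rfl⟩ := h.span x
    rw [add_assoc, add_comm]
    exact AddSubgroup.add_mem_sup ⟨(l, m), coordHom_apply ω θ (l, m)⟩ (intCast_mem R k)
  rw [this, AddSubgroup.relIndex_top_right]

theorem index_dvd_cubicForm (h : IsCubicRingBasis ω θ a b c d) (R : Subring O) {v : ℤ × ℤ}
    (hv : v ∈ R.toAddSubgroup.comap (coordHom ω θ)) :
    (R.toAddSubgroup.index : ℤ) ∣ cubicForm a b c d v.1 v.2 := by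
  obtain ⟨x, y⟩ := v
  have h1 : (x * ω + y * θ) ^ 2 ∈ R := pow_mem (by exact hv) 2
  have h2 : (x * ω + y * θ) ^ 2 = ((-(a * c) * x ^ 2 - 2 * x * y * (a * d) - y ^ 2 * (b * d) : ℤ) : O)
      + (b * x ^ 2 + d * y ^ 2 : ℤ) * ω + (-a * x ^ 2 - c * y ^ 2 : ℤ) * θ := by
    push_cast
    linear_combination (x : O) ^ 2 * h.sq_left + 2 * x * y * h.mul + (y : O) ^ 2 * h.sq_right
  rw [h2, mem_iff_coord] at h1
  have h3 := AddSubgroup.index_dvd_det h1 hv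
  rw [h.index_comap_coordHom] at h3
  convert h3 using 1
  simp only [cubicForm, Int.cast_id]
  ring

theorem card_subring_le (h : IsCubicRingBasis ω θ a b c d) (hO : IsClosedUnderDivision O)
    {n G : ℕ} (hn : 0 < n) (hG : ∀ g, g ^ 3 ∣ n → g ≤ G) :
    Finite {R : Subring O // R.toAddSubgroup.index = n} ∧
    Nat.card {R : Subring O // R.toAddSubgroup.index = n} ≤ n.divisors.card ^ 5 * G := by
  obtain ⟨hfin, hcard⟩ := (h.isMaximalForm hO).card_sublattice_le hn hG
  let F : {R : Subring O // R.toAddSubgroup.index = n} →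
      {L : AddSubgroup (ℤ × ℤ) // L.index = n ∧
        ∀ v ∈ L, (n : ℤ) ∣ cubicForm a b c d v.1 v.2} := fun R =>
    ⟨R.1.toAddSubgroup.comap (coordHom ω θ), (h.index_comap_coordHom R.1).trans R.2,
      fun v hv => R.2 ▸ h.index_dvd_cubicForm R.1 hv⟩
  have hF : Function.Injective F := by
    rintro ⟨R, hR⟩ ⟨S, hS⟩ hRS
    have e := congrArg Subtype.val hRS
    apply Subtype.ext
    ext x
    obtain ⟨k, l, m, rfl⟩ := h.span x
    change R.toAddSubgroup.comap (coordHom ω θ) = S.toAddSubgroup.comap (coordHom ω θ) at e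
    rw [mem_iff_coord, mem_iff_coord, e]
  exact ⟨Finite.of_injective F hF, (Nat.card_le_card_of_injective F hF).trans hcard⟩

end IsCubicRingBasis

open NumberField in
theorem isClosedUnderDivision_ringOfIntegers (K : Type*) [Field K] [NumberField K] :
    IsCubicRingBasis.IsClosedUnderDivision (𝓞 K) := by
  intro p hp x A B D h
  have hp0 : (p : K) ≠ 0 := by exact_mod_cast hp.ne_zero
  have hK := congrArg (algebraMap (𝓞 K) K) h
  push_cast [map_sub, map_add, map_mul, map_pow, map_intCast, map_natCast, map_zero] at hK
  set y : K := algebraMap (𝓞 K) K x / p with hy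
  have hxy : algebraMap (𝓞 K) K x = p * y := by rw [hy]; field_simp
  have hyint : IsIntegral ℤ y := by
    refine ⟨Polynomial.X ^ 3 - Polynomial.C B * Polynomial.X ^ 2 + Polynomial.C A * Polynomial.X
      - Polynomial.C D, by monicity!, ?_⟩
    have h0 : (p : K) ^ 3 * (y ^ 3 - B * y ^ 2 + A * y - D) = 0 := by
      rw [hxy] at hK
      linear_combination hK
    have h1 := (mul_eq_zero.mp h0).resolve_left (pow_ne_zero _ hp0)
    simpa [-Polynomial.map_intCast, -eq_intCast, Polynomial.eval₂_C] using h1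
  let z : 𝓞 K := ⟨y, hyint⟩
  have hz : algebraMap (𝓞 K) K z = y := rfl
  refine ⟨z, RingOfIntegers.ext ?_⟩
  change algebraMap (𝓞 K) K x = algebraMap (𝓞 K) K (p * z)
  rw [hxy, map_mul, map_natCast, hz]

theorem exists_one_basis {O : Type*} [CommRing O] [Module.Free ℤ O] [Module.Finite ℤ O]
    (h3 : Module.finrank ℤ O = 3) (hsat : ∀ (n k : ℤ) (x : O), n ≠ 0 → n * x = k → ∃ m : ℤ, x = m) :
    ∃ ω θ : O, (∀ x : O, ∃ k l m : ℤ, x = k + l * ω + m * θ) ∧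
      ∀ k l m : ℤ, (k : O) + l * ω + m * θ = 0 → k = 0 ∧ l = 0 ∧ m = 0 := by
  have hnt : Nontrivial O := by
    by_contra h
    rw [not_nontrivial_iff_subsingleton] at h
    simp [Module.finrank_zero_of_subsingleton] at h3
  let N : Submodule ℤ O := Submodule.span ℤ {1}
  have hmem : ∀ x : O, N.mkQ x = 0 ↔ ∃ k : ℤ, x = k := by
    intro x
    rw [Submodule.mkQ_apply, Submodule.Quotient.mk_eq_zero, Submodule.mem_span_singleton]
    simp [eq_comm]
  have htf : Module.IsTorsionFree ℤ (O ⧸ N) := by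
    rw [Module.isTorsionFree_iff_smul_eq_zero]
    intro n q hq
    by_contra! hcon
    obtain ⟨hn, hq0⟩ := hcon
    obtain ⟨x, rfl⟩ := N.mkQ_surjective q
    rw [← map_smul, hmem] at hq
    obtain ⟨k, hk⟩ := hq
    apply hq0
    rw [hmem]
    exact hsat n k x hn (by rw [← hk, zsmul_eq_mul])
  have hN1 : Module.finrank ℤ N = 1 := by
    rw [← (LinearEquiv.toSpanNonzeroSingleton ℤ O 1 one_ne_zero).finrank_eq,
      Module.finrank_self]
  have hr2 : Module.finrank ℤ (O ⧸ N) = 2 := by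
    have := N.finrank_quotient_add_finrank
    omega
  let e := Module.finBasisOfFinrankEq ℤ (O ⧸ N) hr2
  obtain ⟨ω, hω⟩ := N.mkQ_surjective (e 0)
  obtain ⟨θ, hθ⟩ := N.mkQ_surjective (e 1)
  have hind : ∀ k l m : ℤ, (k : O) + l * ω + m * θ = 0 → l = 0 ∧ m = 0 := by
    intro k l m h
    have hk : N.mkQ (k : O) = 0 := (hmem _).mpr ⟨k, rfl⟩
    have h1 := congrArg N.mkQ h
    rw [map_add, map_add, hk, zero_add, ← zsmul_eq_mul, ← zsmul_eq_mul, map_smul, map_smul,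
      map_zero, hω, hθ] at h1
    have h2 := Fintype.linearIndependent_iff.mp e.linearIndependent ![l, m]
      (by simpa [Fin.sum_univ_two] using h1)
    exact ⟨h2 0, h2 1⟩
  refine ⟨ω, θ, fun x => ?_, fun k l m h => ?_⟩
  · have h1 := e.sum_repr (N.mkQ x)
    rw [Fin.sum_univ_two, ← hω, ← hθ, ← map_smul, ← map_smul, ← map_add, eq_comm,
      ← sub_eq_zero, ← map_sub, hmem] at h1
    obtain ⟨k, hk⟩ := h1
    refine ⟨k, e.repr (N.mkQ x) 0, e.repr (N.mkQ x) 1, ?_⟩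
    rw [← hk]
    simp only [zsmul_eq_mul]
    ring
  · obtain ⟨rfl, rfl⟩ := hind k l m h
    refine ⟨?_, rfl, rfl⟩
    by_contra hk
    have h1 : (k : O) = 0 := by simpa using h
    have h2 : ∀ x : O, k • x = 0 := fun x => by rw [zsmul_eq_mul, h1, zero_mul]
    have := (smul_eq_zero.mp (h2 1)).resolve_left hk
    exact one_ne_zero this

open NumberField in
theorem exists_one_basis_ringOfIntegers (K : Type*) [Field K] [NumberField K]
    (hK : Module.finrank ℚ K = 3) :
    ∃ ω θ : 𝓞 K, (∀ x : 𝓞 K, ∃ k l m : ℤ, x = k + l * ω + m * θ) ∧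
      ∀ k l m : ℤ, (k : 𝓞 K) + l * ω + m * θ = 0 → k = 0 ∧ l = 0 ∧ m = 0 := by
  refine exists_one_basis (by rw [RingOfIntegers.rank, hK]) fun n k x hn hk => ?_
  have hk' : (n : K) * algebraMap (𝓞 K) K x = k := by
    simpa using congrArg (algebraMap (𝓞 K) K) hk
  have hn' : (n : K) ≠ 0 := by exact_mod_cast hn
  have hxr : algebraMap (𝓞 K) K x = algebraMap ℚ K ((k : ℚ) / n) := by
    rw [map_div₀, map_intCast, map_intCast, eq_div_iff hn', mul_comm, hk']
  have hqint : IsIntegral ℤ ((k : ℚ) / n) := by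
    have h1 : IsIntegral ℤ (algebraMap ℚ K ((k : ℚ) / n)) := hxr ▸ x.isIntegral_coe
    exact (isIntegral_algebraMap_iff (algebraMap ℚ K).injective).mp h1
  obtain ⟨m, hm⟩ := IsIntegrallyClosed.isIntegral_iff.mp hqint
  refine ⟨m, RingOfIntegers.ext ?_⟩
  change algebraMap (𝓞 K) K x = algebraMap (𝓞 K) K m
  rw [hxr, ← hm]
  simp

open NumberField in
theorem det_sq_eq_discr {K : Type*} [Field K] [NumberField K]
    {ω θ : 𝓞 K} (span : ∀ x : 𝓞 K, ∃ k l m : ℤ, x = k + l * ω + m * θ)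
    (indep : ∀ k l m : ℤ, (k : 𝓞 K) + l * ω + m * θ = 0 → k = 0 ∧ l = 0 ∧ m = 0)
    (e : Fin 3 ≃ (K →ₐ[ℚ] ℂ)) :
    (Matrix.of fun i j => e j (algebraMap (𝓞 K) K (![1, ω, θ] i)) :
      Matrix (Fin 3) (Fin 3) ℂ).det ^ 2 =
      (discr K : ℂ) := by
  have hli : LinearIndependent ℤ ![(1 : 𝓞 K), ω, θ] := by
    rw [Fintype.linearIndependent_iff]
    intro g hg i
    simp only [Fin.sum_univ_three, zsmul_eq_mul] at hg
    obtain ⟨h0, h1, h2⟩ := indep (g 0) (g 1) (g 2) (by simpa using hg)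
    fin_cases i <;> assumption
  have hsp : ⊤ ≤ Submodule.span ℤ (Set.range ![(1 : 𝓞 K), ω, θ]) := by
    intro x _
    obtain ⟨k, l, m, rfl⟩ := span x
    rw [Submodule.mem_span_range_iff_exists_fun]
    exact ⟨![k, l, m], by simp [Fin.sum_univ_three]⟩
  let b := Module.Basis.mk hli hsp
  have hb : ⇑b = ![(1 : 𝓞 K), ω, θ] := Module.Basis.coe_mk hli hsp
  have h1 : Algebra.discr ℚ (b.localizationLocalization ℚ (nonZeroDivisors ℤ) K) = discr K := by
    rw [Algebra.discr_localizationLocalization, NumberField.discr_eq_discr]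
    simp
  have h2 := Algebra.discr_eq_det_embeddingsMatrixReindex_pow_two ℚ ℂ
    (b.localizationLocalization ℚ (nonZeroDivisors ℤ) K) e
  rw [h1] at h2
  simp only [map_intCast] at h2
  rw [h2]
  congr 2
  ext i j
  simp [Algebra.embeddingsMatrixReindex, Algebra.embeddingsMatrix, hb]

theorem norm_sq_mul_eq_of_sum_eq_zero {p₁ p₂ p₃ s₁ s₂ s₃ : ℂ} (hp : p₁ + p₂ + p₃ = 0)
    (hs : s₁ + s₂ + s₃ = 0) :
    (‖p₁‖ ^ 2 + ‖p₂‖ ^ 2 + ‖p₃‖ ^ 2) * (‖s₁‖ ^ 2 + ‖s₂‖ ^ 2 + ‖s₃‖ ^ 2) =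
      ‖p₁ * star s₁ + p₂ * star s₂ + p₃ * star s₃‖ ^ 2 + 3 * ‖p₁ * s₂ - p₂ * s₁‖ ^ 2 := by
  obtain rfl : p₃ = -p₁ - p₂ := by linear_combination hp
  obtain rfl : s₃ = -s₁ - s₂ := by linear_combination hs
  have key : ∀ z : ℂ, ((‖z‖ ^ 2 : ℝ) : ℂ) = z * star z := fun z => by
    rw [← Complex.normSq_eq_norm_sq, Complex.star_def, Complex.mul_conj]
  rw [← Complex.ofReal_inj]
  simp only [Complex.ofReal_mul, Complex.ofReal_add, key, Complex.ofReal_ofNat, star_add, star_mul,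
    star_sub, star_neg, star_star]
  ring

theorem intWeight_of_ne_zero {n : ℤ} (hn : n ≠ 0) : intWeight n = |(n : ℝ)| := by
  rw [intWeight, max_eq_right]
  exact_mod_cast Int.one_le_abs hn

theorem intWeight_mul_le_of_abs_mul_le {a b c d : ℤ} {P S Δ : ℝ} (hP0 : 0 ≤ P) (hS0 : 0 ≤ S)
    (hΔ1 : 1 ≤ Δ) (ha : a ≠ 0) (hd : d ≠ 0) (na : |(a : ℝ)| * Δ ≤ P ^ 3)
    (nb : |(b : ℝ)| * Δ ≤ 3 * (P ^ 2 * S)) (nc : |(c : ℝ)| * Δ ≤ 3 * (P * S ^ 2))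
    (nd : |(d : ℝ)| * Δ ≤ S ^ 3) (hq : P ^ 2 * S ^ 2 ≤ 7 * Δ ^ 2) :
    intWeight a * (intWeight b * (intWeight c * intWeight d)) ≤ 9 * 7 ^ 3 * Δ ^ 2 := by
  have hΔ0 : 0 ≤ Δ := by linarith
  have ha1 : 1 ≤ |(a : ℝ)| := by exact_mod_cast Int.one_le_abs ha
  have hd1 : 1 ≤ |(d : ℝ)| := by exact_mod_cast Int.one_le_abs hd
  have hP3 : Δ ≤ P ^ 3 := (le_mul_of_one_le_left hΔ0 ha1).trans na
  have hS3 : Δ ≤ S ^ 3 := (le_mul_of_one_le_left hΔ0 hd1).trans nd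
  have mb : intWeight b * Δ ≤ 3 * (P ^ 2 * S) := by
    rw [intWeight, max_mul_of_nonneg _ _ hΔ0]
    refine max_le ?_ nb
    have : Δ ^ 3 ≤ (P ^ 2 * S) ^ 3 :=
      calc Δ ^ 3 = Δ ^ 2 * Δ := by ring
        _ ≤ (P ^ 3) ^ 2 * S ^ 3 := by gcongr
        _ = (P ^ 2 * S) ^ 3 := by ring
    have := le_of_pow_le_pow_left₀ three_ne_zero (by positivity) this
    nlinarith
  have mc : intWeight c * Δ ≤ 3 * (P * S ^ 2) := by
    rw [intWeight, max_mul_of_nonneg _ _ hΔ0]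
    refine max_le ?_ nc
    have : Δ ^ 3 ≤ (P * S ^ 2) ^ 3 :=
      calc Δ ^ 3 = Δ * Δ ^ 2 := by ring
        _ ≤ P ^ 3 * (S ^ 3) ^ 2 := by gcongr
        _ = (P * S ^ 2) ^ 3 := by ring
    have := le_of_pow_le_pow_left₀ three_ne_zero (by positivity) this
    nlinarith
  rw [intWeight_of_ne_zero ha, intWeight_of_ne_zero hd]
  have hfin : (|(a : ℝ)| * (intWeight b * (intWeight c * |(d : ℝ)|))) * (Δ ^ 2) ^ 2 ≤
      9 * 7 ^ 3 * Δ ^ 2 * (Δ ^ 2) ^ 2 :=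
    calc (|(a : ℝ)| * (intWeight b * (intWeight c * |(d : ℝ)|))) * (Δ ^ 2) ^ 2
        = (|(a : ℝ)| * Δ) * ((intWeight b * Δ) * ((intWeight c * Δ) * (|(d : ℝ)| * Δ))) := by
          ring
      _ ≤ P ^ 3 * ((3 * (P ^ 2 * S)) * ((3 * (P * S ^ 2)) * S ^ 3)) := by
          have := intWeight_pos b
          have := intWeight_pos c
          gcongr
      _ = 9 * (P ^ 2 * S ^ 2) ^ 3 := by ring
      _ ≤ 9 * (7 * Δ ^ 2) ^ 3 := by gcongr
      _ = 9 * 7 ^ 3 * Δ ^ 2 * (Δ ^ 2) ^ 2 := by ring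
  exact le_of_mul_le_mul_right hfin (by positivity)

theorem mul_le_of_gram {q₁ q₂ β D : ℝ} (h₁ : 1 ≤ q₁) (h₂ : 1 ≤ q₂) (hβ : 0 ≤ β)
    (hB : β ≤ (min q₁ q₂ + 1 / 2) / 2) (hL : q₁ * q₂ = β ^ 2 + 3 * D) : q₁ * q₂ ≤ 7 * D := by
  have h1 : β ≤ 3 / 4 * q₁ := by linarith [min_le_left q₁ q₂]
  have h2 : β ≤ 3 / 4 * q₂ := by linarith [min_le_right q₁ q₂]
  have h3 : β * β ≤ (3 / 4 * q₁) * (3 / 4 * q₂) := by gcongr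
  nlinarith

/-- A nearly reduced cubic ring basis has an index form with small coefficients. -/
theorem intWeight_mul_le_of_reduced {w₁ w₂ w₃ t₁ t₂ t₃ : ℂ} {a b c d : ℤ} {p₁ p₂ p₃ s₁ s₂ s₃ δ : ℂ}
    {D : ℝ} (hp₁ : p₁ = w₂ - w₃) (hp₂ : p₂ = w₃ - w₁) (hp₃ : p₃ = w₁ - w₂)
    (hs₁ : s₁ = t₂ - t₃) (hs₂ : s₂ = t₃ - t₁) (hs₃ : s₃ = t₁ - t₂)
    (hδ : δ = p₁ * s₂ - p₂ * s₁) (ha : a ≠ 0) (hd : d ≠ 0)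
    (hw₁ : w₁ ^ 2 = -(a * c) + b * w₁ - a * t₁) (hw₂ : w₂ ^ 2 = -(a * c) + b * w₂ - a * t₂)
    (hw₃ : w₃ ^ 2 = -(a * c) + b * w₃ - a * t₃)
    (hm₁ : w₁ * t₁ = -(a * d)) (hm₂ : w₂ * t₂ = -(a * d)) (hm₃ : w₃ * t₃ = -(a * d))
    (ht₁ : t₁ ^ 2 = -(b * d) + d * w₁ - c * t₁) (ht₂ : t₂ ^ 2 = -(b * d) + d * w₂ - c * t₂)
    (ht₃ : t₃ ^ 2 = -(b * d) + d * w₃ - c * t₃)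
    (hD : ‖δ‖ ^ 2 = D) (hD1 : 1 ≤ D)
    (hB : ‖p₁ * star s₁ + p₂ * star s₂ + p₃ * star s₃‖ ≤
      (min (‖p₁‖ ^ 2 + ‖p₂‖ ^ 2 + ‖p₃‖ ^ 2) (‖s₁‖ ^ 2 + ‖s₂‖ ^ 2 + ‖s₃‖ ^ 2) + 1 / 2) / 2) :
    intWeight a * (intWeight b * (intWeight c * intWeight d)) ≤ 9 * 7 ^ 3 * D := by
  have ea : p₁ * p₂ * p₃ = -a * δ := by
    subst hp₁ hp₂ hp₃ hs₁ hs₂ hs₃ hδ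
    linear_combination (w₃ - w₂) * hw₁ + (w₁ - w₃) * hw₂ + (w₂ - w₁) * hw₃
  have eb : p₁ * p₂ * s₃ + p₁ * s₂ * p₃ + s₁ * p₂ * p₃ = -b * δ := by
    subst hp₁ hp₂ hp₃ hs₁ hs₂ hs₃ hδ
    linear_combination 2 * ((w₃ - w₂) * hm₁ + (w₁ - w₃) * hm₂ + (w₂ - w₁) * hm₃) +
      ((t₃ - t₂) * hw₁ + (t₁ - t₃) * hw₂ + (t₂ - t₁) * hw₃)
  have ec : s₁ * s₂ * p₃ + s₁ * p₂ * s₃ + p₁ * s₂ * s₃ = -c * δ := by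
    subst hp₁ hp₂ hp₃ hs₁ hs₂ hs₃ hδ
    linear_combination 2 * ((t₃ - t₂) * hm₁ + (t₁ - t₃) * hm₂ + (t₂ - t₁) * hm₃) +
      ((w₃ - w₂) * ht₁ + (w₁ - w₃) * ht₂ + (w₂ - w₁) * ht₃)
  have ed : s₁ * s₂ * s₃ = -d * δ := by
    subst hp₁ hp₂ hp₃ hs₁ hs₂ hs₃ hδ
    linear_combination (t₃ - t₂) * ht₁ + (t₁ - t₃) * ht₂ + (t₂ - t₁) * ht₃
  have hL := norm_sq_mul_eq_of_sum_eq_zero (p₁ := p₁) (p₂ := p₂) (p₃ := p₃) (s₁ := s₁) (s₂ := s₂)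
    (s₃ := s₃) (by subst hp₁ hp₂ hp₃; ring) (by subst hs₁ hs₂ hs₃; ring)
  rw [← hδ, hD] at hL
  have hΔ0 : 0 ≤ ‖δ‖ := norm_nonneg δ
  set Δ := ‖δ‖
  set q₁ := ‖p₁‖ ^ 2 + ‖p₂‖ ^ 2 + ‖p₃‖ ^ 2 with hq₁
  set q₂ := ‖s₁‖ ^ 2 + ‖s₂‖ ^ 2 + ‖s₃‖ ^ 2 with hq₂
  set β := ‖p₁ * star s₁ + p₂ * star s₂ + p₃ * star s₃‖
  have hβ0 : 0 ≤ β := norm_nonneg _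
  have hΔ1 : 1 ≤ Δ := by nlinarith
  have hq₁0 : 0 ≤ q₁ := by positivity
  have hq₂0 : 0 ≤ q₂ := by positivity
  set P := √q₁ with hP
  set S := √q₂ with hS
  have hP0 : 0 ≤ P := Real.sqrt_nonneg _
  have hS0 : 0 ≤ S := Real.sqrt_nonneg _
  have hPq : P ^ 2 = q₁ := Real.sq_sqrt hq₁0
  have hSq : S ^ 2 = q₂ := Real.sq_sqrt hq₂0
  have bp₁ : ‖p₁‖ ≤ P := Real.le_sqrt_of_sq_le (by nlinarith [sq_nonneg ‖p₂‖, sq_nonneg ‖p₃‖])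
  have bp₂ : ‖p₂‖ ≤ P := Real.le_sqrt_of_sq_le (by nlinarith [sq_nonneg ‖p₁‖, sq_nonneg ‖p₃‖])
  have bp₃ : ‖p₃‖ ≤ P := Real.le_sqrt_of_sq_le (by nlinarith [sq_nonneg ‖p₂‖, sq_nonneg ‖p₁‖])
  have bs₁ : ‖s₁‖ ≤ S := Real.le_sqrt_of_sq_le (by nlinarith [sq_nonneg ‖s₂‖, sq_nonneg ‖s₃‖])
  have bs₂ : ‖s₂‖ ≤ S := Real.le_sqrt_of_sq_le (by nlinarith [sq_nonneg ‖s₁‖, sq_nonneg ‖s₃‖])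
  have bs₃ : ‖s₃‖ ≤ S := Real.le_sqrt_of_sq_le (by nlinarith [sq_nonneg ‖s₂‖, sq_nonneg ‖s₁‖])
  have three : ∀ {x y z : ℂ} {A B C : ℝ}, 0 ≤ A → 0 ≤ B → ‖x‖ ≤ A → ‖y‖ ≤ B → ‖z‖ ≤ C →
      ‖x * y * z‖ ≤ A * B * C := by
    intro x y z A B C hA hB hx hy hz
    rw [norm_mul, norm_mul]
    gcongr
  have na : |(a : ℝ)| * Δ ≤ P ^ 3 := by
    have h : ‖-(a : ℂ) * δ‖ ≤ P * P * P := ea ▸ three hP0 hP0 bp₁ bp₂ bp₃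
    rw [norm_mul, norm_neg, Complex.norm_intCast] at h
    linarith
  have nd : |(d : ℝ)| * Δ ≤ S ^ 3 := by
    have h : ‖-(d : ℂ) * δ‖ ≤ S * S * S := ed ▸ three hS0 hS0 bs₁ bs₂ bs₃
    rw [norm_mul, norm_neg, Complex.norm_intCast] at h
    linarith
  have nb : |(b : ℝ)| * Δ ≤ 3 * (P ^ 2 * S) := by
    have h : ‖-(b : ℂ) * δ‖ ≤ P * P * S + P * S * P + S * P * P := by
      rw [← eb]
      exact norm_add₃_le.trans (add_le_add (add_le_add (three hP0 hP0 bp₁ bp₂ bs₃)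
        (three hP0 hS0 bp₁ bs₂ bp₃)) (three hS0 hP0 bs₁ bp₂ bp₃))
    rw [norm_mul, norm_neg, Complex.norm_intCast] at h
    linarith
  have nc : |(c : ℝ)| * Δ ≤ 3 * (P * S ^ 2) := by
    have h : ‖-(c : ℂ) * δ‖ ≤ S * S * P + S * P * S + P * S * S := by
      rw [← ec]
      exact norm_add₃_le.trans (add_le_add (add_le_add (three hS0 hS0 bs₁ bs₂ bp₃)
        (three hS0 hP0 bs₁ bp₂ bs₃)) (three hP0 hS0 bp₁ bs₂ bs₃))
    rw [norm_mul, norm_neg, Complex.norm_intCast] at h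
    linarith
  have ha1 : 1 ≤ |(a : ℝ)| := by exact_mod_cast Int.one_le_abs ha
  have hd1 : 1 ≤ |(d : ℝ)| := by exact_mod_cast Int.one_le_abs hd
  have hP3 : Δ ≤ P ^ 3 := (le_mul_of_one_le_left hΔ0 ha1).trans na
  have hS3 : Δ ≤ S ^ 3 := (le_mul_of_one_le_left hΔ0 hd1).trans nd
  have hP1 : 1 ≤ P := by
    by_contra! h
    linarith [pow_lt_one₀ hP0 h three_ne_zero]
  have hS1 : 1 ≤ S := by
    by_contra! h
    linarith [pow_lt_one₀ hS0 h three_ne_zero]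
  have hq : q₁ * q₂ ≤ 7 * D :=
    mul_le_of_gram (hPq ▸ one_le_pow₀ hP1) (hSq ▸ one_le_pow₀ hS1) hβ0 hB hL
  rw [← hD] at hq ⊢
  exact intWeight_mul_le_of_abs_mul_le hP0 hS0 hΔ1 ha hd na nb nc nd (by rwa [hPq, hSq])

section SmallBasis

open NumberField

/-- The sum over pairs of embeddings of `|σ u - τ u|²`. -/
def embeddingSpread {K : Type*} [Field K] [NumberField K] (u : K) : ℝ :=
  ∑ σ : K →+* ℂ, ∑ τ : K →+* ℂ, ‖σ u - τ u‖ ^ 2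

/-- The hermitian form attached to `embeddingSpread`. -/
def embeddingPairing {K : Type*} [Field K] [NumberField K] (u v : K) : ℂ :=
  ∑ σ : K →+* ℂ, ∑ τ : K →+* ℂ, (σ u - τ u) * star (σ v - τ v)

section Spread

variable {K : Type*} [Field K] [NumberField K]

theorem embeddingSpread_nonneg (u : K) : 0 ≤ embeddingSpread u :=
  Finset.sum_nonneg fun _ _ => Finset.sum_nonneg fun _ _ => by positivity

theorem embeddingSpread_add (u v : K) : embeddingSpread (u + v) =
    embeddingSpread u + embeddingSpread v + 2 * (embeddingPairing u v).re := by
  simp only [embeddingSpread, embeddingPairing, Complex.re_sum, Finset.mul_sum,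
    ← Finset.sum_add_distrib]
  refine Finset.sum_congr rfl fun σ _ => Finset.sum_congr rfl fun τ _ => ?_
  have : σ (u + v) - τ (u + v) = (σ u - τ u) + (σ v - τ v) := by
    rw [map_add, map_add]; ring
  rw [this, ← Complex.normSq_eq_norm_sq, ← Complex.normSq_eq_norm_sq, ← Complex.normSq_eq_norm_sq,
    Complex.normSq_add]
  rfl

theorem embeddingSpread_neg (u : K) : embeddingSpread (-u) = embeddingSpread u := by
  simp only [embeddingSpread, map_neg]
  refine Finset.sum_congr rfl fun σ _ => Finset.sum_congr rfl fun τ _ => ?_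
  rw [← norm_neg]
  congr 2
  ring

theorem embeddingPairing_neg_right (u v : K) : embeddingPairing u (-v) = -embeddingPairing u v := by
  simp only [embeddingPairing, map_neg, ← Finset.sum_neg_distrib]
  refine Finset.sum_congr rfl fun σ _ => Finset.sum_congr rfl fun τ _ => ?_
  simp only [star_sub, star_neg]
  ring

theorem embeddingSpread_sub_intCast (u : K) (n : ℤ) :
    embeddingSpread (u - n) = embeddingSpread u := by
  simp [embeddingSpread]

theorem embeddingPairing_sub_intCast (u v : K) (m n : ℤ) :
    embeddingPairing (u - m) (v - n) = embeddingPairing u v := by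
  simp [embeddingPairing]

theorem star_embeddingPairing (u v : K) : star (embeddingPairing u v) = embeddingPairing u v := by
  let π : Equiv.Perm (K →+* ℂ) := (ComplexEmbedding.involutive_conjugate K).toPerm
  have hπ : ∀ (σ : K →+* ℂ) (x : K), star (σ x) = π σ x := fun σ x => rfl
  simp only [embeddingPairing, star_sum, star_mul, star_sub, star_star]
  simp only [hπ]
  rw [← Equiv.sum_comp π]
  refine Finset.sum_congr rfl fun σ _ => ?_
  rw [← Equiv.sum_comp π]
  refine Finset.sum_congr rfl fun τ _ => ?_
  have hππ : ∀ σ : K →+* ℂ, π (π σ) = σ := ComplexEmbedding.involutive_conjugate K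
  simp only [hππ]
  ring

theorem norm_embeddingPairing (u v : K) :
    ‖embeddingPairing u v‖ = |(embeddingPairing u v).re| := by
  have h := star_embeddingPairing u v
  rw [Complex.star_def, Complex.conj_eq_iff_re] at h
  rw [← Real.norm_eq_abs, ← Complex.norm_real, h]

theorem two_mul_norm_embeddingPairing_le {u v : K}
    (h₁ : embeddingSpread u ≤ embeddingSpread (u + v) + 1)
    (h₂ : embeddingSpread u ≤ embeddingSpread (u + -v) + 1) :
    2 * ‖embeddingPairing u v‖ ≤ embeddingSpread v + 1 := by
  rw [norm_embeddingPairing]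
  rw [embeddingSpread_add] at h₁ h₂
  rw [embeddingSpread_neg, embeddingPairing_neg_right, Complex.neg_re] at h₂
  cases abs_cases (embeddingPairing u v).re <;> linarith

theorem norm_embeddingPairing_comm (u v : K) :
    ‖embeddingPairing u v‖ = ‖embeddingPairing v u‖ := by
  rw [← norm_star (embeddingPairing u v)]
  congr 1
  simp only [embeddingPairing, star_sum, star_mul, star_star]

/-- There is a `ℤ`-basis `1, ω, θ` of the ring of integers in which `ω, θ` are almost reduced. -/
theorem exists_reduced_basis_ringOfIntegers (hK : Module.finrank ℚ K = 3) :
    ∃ ω θ : 𝓞 K, (∀ x : 𝓞 K, ∃ k l m : ℤ, x = k + l * ω + m * θ) ∧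
      (∀ k l m : ℤ, (k : 𝓞 K) + l * ω + m * θ = 0 → k = 0 ∧ l = 0 ∧ m = 0) ∧
      2 * ‖embeddingPairing (ω : K) (θ : K)‖ ≤
        min (embeddingSpread (ω : K)) (embeddingSpread (θ : K)) + 1 := by
  let T : Set ℝ := {r | ∃ ω θ : 𝓞 K, (∀ x : 𝓞 K, ∃ k l m : ℤ, x = k + l * ω + m * θ) ∧
      (∀ k l m : ℤ, (k : 𝓞 K) + l * ω + m * θ = 0 → k = 0 ∧ l = 0 ∧ m = 0) ∧
      r = embeddingSpread (ω : K) + embeddingSpread (θ : K)}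
  have hT : T.Nonempty := by
    obtain ⟨ω, θ, h1, h2⟩ := exists_one_basis_ringOfIntegers K hK
    exact ⟨_, ω, θ, h1, h2, rfl⟩
  have hTb : BddBelow T := by
    refine ⟨0, ?_⟩
    rintro _ ⟨ω, θ, -, -, rfl⟩
    exact add_nonneg (embeddingSpread_nonneg _) (embeddingSpread_nonneg _)
  obtain ⟨_, ⟨ω, θ, hsp, hin, rfl⟩, hmin⟩ := Real.lt_sInf_add_pos hT one_pos
  have hle : ∀ s t : ℤ, s = 0 ∨ t = 0 →
      embeddingSpread (ω : K) + embeddingSpread (θ : K) ≤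
        embeddingSpread ((ω : K) + s * θ) + embeddingSpread ((θ : K) + t * ω) + 1 := by
    intro s t hst
    have hst' : (s : 𝓞 K) * t = 0 := by
      rcases hst with rfl | rfl <;> simp
    have hmem : embeddingSpread ((ω + s * θ : 𝓞 K) : K) +
        embeddingSpread ((θ + t * ω : 𝓞 K) : K) ∈ T := by
      refine ⟨_, _, fun x => ?_, fun k l m h => ?_, rfl⟩
      · obtain ⟨k, l, m, rfl⟩ := hsp x
        refine ⟨k, l - m * t, m - l * s, ?_⟩
        push_cast
        linear_combination ((l : 𝓞 K) * ω + m * θ) * hst'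
      · obtain ⟨h1, h2, h3⟩ := hin k (l + m * t) (m + l * s) (by
          push_cast; linear_combination h)
        rcases hst with rfl | rfl
        · have : m = 0 := by simpa using h3
          subst this
          exact ⟨h1, by simpa using h2, rfl⟩
        · have : l = 0 := by simpa using h2
          subst this
          exact ⟨h1, rfl, by simpa using h3⟩
    have h := csInf_le hTb hmem
    simp only [map_add, map_mul, map_intCast] at h
    linarith
  refine ⟨ω, θ, hsp, hin, ?_⟩
  rw [← min_add_add_right, le_min_iff]
  constructor
  · rw [norm_embeddingPairing_comm]
    refine two_mul_norm_embeddingPairing_le ?_ ?_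
    · have := hle 0 1 (.inl rfl)
      simp only [Int.cast_zero, zero_mul, add_zero, Int.cast_one, one_mul] at this
      linarith
    · have := hle 0 (-1) (.inl rfl)
      simp only [Int.cast_zero, zero_mul, add_zero, Int.cast_one, one_mul, Int.cast_neg,
        neg_mul] at this
      linarith
  · refine two_mul_norm_embeddingPairing_le ?_ ?_
    · have := hle 1 0 (.inr rfl)
      simp only [Int.cast_zero, zero_mul, add_zero, Int.cast_one, one_mul] at this
      linarith
    · have := hle (-1) 0 (.inr rfl)
      simp only [Int.cast_zero, zero_mul, add_zero, Int.cast_one, one_mul, Int.cast_neg,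
        neg_mul] at this
      linarith

end Spread

theorem IsCubicRingBasis.left_ne_zero {O : Type*} [CommRing O] [IsDomain O] {ω θ : O}
    {a b c d : ℤ} (h : IsCubicRingBasis ω θ a b c d) : a ≠ 0 := by
  rintro rfl
  have h1 : ω * (ω - b) = 0 := by
    have := h.sq_left
    push_cast at this
    linear_combination this
  rcases mul_eq_zero.mp h1 with h2 | h2
  · exact one_ne_zero (h.indep 0 1 0 (by push_cast; linear_combination h2)).2.1
  · exact one_ne_zero (h.indep (-b) 1 0 (by push_cast; linear_combination h2)).2.1

theorem IsCubicRingBasis.right_ne_zero {O : Type*} [CommRing O] [IsDomain O] {ω θ : O}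
    {a b c d : ℤ} (h : IsCubicRingBasis ω θ a b c d) : d ≠ 0 :=
  h.symm.left_ne_zero

theorem exists_isCubicRingBasis_intWeight_le (K : Type*) [Field K] [NumberField K]
    (hK : Module.finrank ℚ K = 3) : ∃ (ω θ : 𝓞 K) (a b c d : ℤ), IsCubicRingBasis ω θ a b c d ∧
      intWeight a * (intWeight b * (intWeight c * intWeight d)) ≤
        9 * 7 ^ 3 * |(discr K : ℝ)| := by
  obtain ⟨ω₀, θ₀, hsp, hin, hred⟩ := exists_reduced_basis_ringOfIntegers hK
  obtain ⟨r, s, a, b, c, d, h⟩ := exists_isCubicRingBasis hsp hin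
  refine ⟨_, _, a, b, c, d, h, ?_⟩
  rw [← embeddingPairing_sub_intCast _ _ r s, ← embeddingSpread_sub_intCast (ω₀ : K) r,
    ← embeddingSpread_sub_intCast (θ₀ : K) s] at hred
  have e1 : algebraMap (𝓞 K) K ω₀ - r = algebraMap (𝓞 K) K (ω₀ - r) := by simp
  have e2 : algebraMap (𝓞 K) K θ₀ - s = algebraMap (𝓞 K) K (θ₀ - s) := by simp
  rw [e1, e2] at hred
  generalize ω₀ - (r : 𝓞 K) = ω at *
  generalize θ₀ - (s : 𝓞 K) = θ at *
  have hcard : Fintype.card (K →+* ℂ) = 3 := by rw [Embeddings.card, hK]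
  let e : Fin 3 ≃ (K →+* ℂ) := (Fintype.equivFinOfCardEq hcard).symm
  have hdet := det_sq_eq_discr h.span h.indep (e.trans (RingHom.equivRatAlgHom K ℂ))
  have hdet' : ∀ i (x : K), e.trans (RingHom.equivRatAlgHom K ℂ) i x = e i x := fun i x => rfl
  rw [Matrix.det_fin_three] at hdet
  simp only [Matrix.of_apply, hdet', Matrix.cons_val_zero, Matrix.cons_val_one, Matrix.cons_val,
    map_one, one_mul] at hdet
  simp only [embeddingPairing, embeddingSpread, ← e.sum_comp, Fin.sum_univ_three] at hred
  have toC : ∀ {x y : 𝓞 K} (i : Fin 3), x = y →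
      e i (algebraMap (𝓞 K) K x) = e i (algebraMap (𝓞 K) K y) := fun i h => by rw [h]
  have hsq : ∀ i, (e i (algebraMap (𝓞 K) K ω)) ^ 2 = -(a * c) + b * e i (algebraMap (𝓞 K) K ω) -
      a * e i (algebraMap (𝓞 K) K θ) := fun i => by simpa using toC i h.sq_left
  have hmul : ∀ i, e i (algebraMap (𝓞 K) K ω) * e i (algebraMap (𝓞 K) K θ) = -(a * d) :=
    fun i => by simpa using toC i h.mul
  have hsq' : ∀ i, (e i (algebraMap (𝓞 K) K θ)) ^ 2 = -(b * d) + d * e i (algebraMap (𝓞 K) K ω) -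
      c * e i (algebraMap (𝓞 K) K θ) := fun i => by simpa using toC i h.sq_right
  refine intWeight_mul_le_of_reduced rfl rfl rfl rfl rfl rfl rfl h.left_ne_zero h.right_ne_zero
    (hsq 0) (hsq 1) (hsq 2) (hmul 0) (hmul 1) (hmul 2) (hsq' 0) (hsq' 1) (hsq' 2) ?_ ?_ ?_
  · rw [← norm_pow, ← Complex.norm_intCast, ← hdet]
    congr 1
    ring
  · exact_mod_cast Int.one_le_abs (discr_ne_zero K)
  · generalize e 0 (algebraMap (𝓞 K) K ω) = w₁ at *
    generalize e 1 (algebraMap (𝓞 K) K ω) = w₂ at *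
    generalize e 2 (algebraMap (𝓞 K) K ω) = w₃ at *
    generalize e 0 (algebraMap (𝓞 K) K θ) = t₁ at *
    generalize e 1 (algebraMap (𝓞 K) K θ) = t₂ at *
    generalize e 2 (algebraMap (𝓞 K) K θ) = t₃ at *
    have hq : ∀ x y z : ℂ, ‖x - x‖ ^ 2 + ‖x - y‖ ^ 2 + ‖x - z‖ ^ 2 +
        (‖y - x‖ ^ 2 + ‖y - y‖ ^ 2 + ‖y - z‖ ^ 2) + (‖z - x‖ ^ 2 + ‖z - y‖ ^ 2 + ‖z - z‖ ^ 2) =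
        2 * (‖y - z‖ ^ 2 + ‖z - x‖ ^ 2 + ‖x - y‖ ^ 2) := by
      intro x y z
      rw [norm_sub_rev y x, norm_sub_rev z y, norm_sub_rev x z]
      simp only [sub_self, norm_zero]
      ring
    rw [hq, hq, ← mul_min_of_nonneg _ _ zero_le_two] at hred
    have hB : 4 * ‖(w₂ - w₃) * star (t₂ - t₃) + (w₃ - w₁) * star (t₃ - t₁) +
        (w₁ - w₂) * star (t₁ - t₂)‖ ≤ 2 * min (‖w₂ - w₃‖ ^ 2 + ‖w₃ - w₁‖ ^ 2 + ‖w₁ - w₂‖ ^ 2)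
          (‖t₂ - t₃‖ ^ 2 + ‖t₃ - t₁‖ ^ 2 + ‖t₁ - t₂‖ ^ 2) + 1 := by
      refine le_trans (le_of_eq ?_) hred
      rw [show (4 : ℝ) = 2 * ‖(2 : ℂ)‖ by norm_num, mul_assoc, ← norm_mul]
      congr 2
      simp only [star_sub]
      ring
    linarith

end SmallBasis

theorem IntermediateField.adjoin_simple_eq_of_finrank_eq_three {K : IntermediateField ℚ Qbar}
    (hK : Module.finrank ℚ K = 3) {α : Qbar} (hα : α ∈ K) (hα' : ∀ q : ℚ, algebraMap ℚ Qbar q ≠ α) :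
    IntermediateField.adjoin ℚ {α} = K := by
  have hfd : FiniteDimensional ℚ K := Module.finite_of_finrank_pos (by omega)
  have hle : IntermediateField.adjoin ℚ {α} ≤ K := by
    rw [IntermediateField.adjoin_le_iff]
    simpa using hα
  have hdvd := IntermediateField.finrank_dvd_of_le_right hle
  rw [hK] at hdvd
  rcases (Nat.dvd_prime Nat.prime_three).mp hdvd with h1 | h1
  · exfalso
    rw [IntermediateField.finrank_adjoin_simple_eq_one_iff, IntermediateField.mem_bot] at h1
    obtain ⟨q, hq⟩ := h1
    exact hα' q hq
  · exact IntermediateField.eq_of_le_of_finrank_eq hle (by rw [h1, hK])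

open Polynomial in
/-- The characteristic polynomial of `ω` when `1, ω, θ` is a normalized basis with index form
`a, b, c, d`. -/
def indexFormCharpoly (v : ℤ × ℤ × ℤ × ℤ) : Polynomial Qbar :=
  X ^ 3 + C (-v.2.1 : Qbar) * X ^ 2 + C (v.1 * v.2.2.1 : Qbar) * X +
    C (-v.1 ^ 2 * v.2.2.2 : Qbar)

theorem natDegree_indexFormCharpoly (v : ℤ × ℤ × ℤ × ℤ) : (indexFormCharpoly v).natDegree = 3 := by
  unfold indexFormCharpoly
  compute_degree!

theorem indexFormCharpoly_ne_zero (v : ℤ × ℤ × ℤ × ℤ) : indexFormCharpoly v ≠ 0 := by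
  intro h
  simpa [h] using natDegree_indexFormCharpoly v

open NumberField in
theorem exists_eq_adjoin_root_indexFormCharpoly {K : IntermediateField ℚ Qbar}
    (hK : Module.finrank ℚ K = 3) : ∃ v : ℤ × ℤ × ℤ × ℤ, ∃ α ∈ (indexFormCharpoly v).roots,
      IntermediateField.adjoin ℚ {α} = K ∧
      intWeight v.1 * (intWeight v.2.1 * (intWeight v.2.2.1 * intWeight v.2.2.2)) ≤
        9 * 7 ^ 3 * |(discrOf K : ℝ)| := by
  have hfd : FiniteDimensional ℚ K := Module.finite_of_finrank_pos (by omega)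
  obtain ⟨ω, θ, a, b, c, d, h, hle⟩ := exists_isCubicRingBasis_intWeight_le K hK
  refine ⟨(a, b, c, d), ((algebraMap (𝓞 K) K ω : K) : Qbar), ?_, ?_, ?_⟩
  · rw [Polynomial.mem_roots (indexFormCharpoly_ne_zero _), Polynomial.IsRoot.def]
    have h1 := congrArg (fun x : 𝓞 K => ((algebraMap (𝓞 K) K x : K) : Qbar)) h.charpoly_left
    simp only [map_sub, map_add, map_mul, map_pow, map_intCast, map_zero] at h1
    push_cast at h1
    simp only [indexFormCharpoly, Polynomial.eval_add, Polynomial.eval_mul, Polynomial.eval_pow,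
      Polynomial.eval_X, Polynomial.eval_C]
    linear_combination h1
  · refine IntermediateField.adjoin_simple_eq_of_finrank_eq_three hK (SetLike.coe_mem _) ?_
    intro q hq
    have hq' : algebraMap ℚ K q = algebraMap (𝓞 K) K ω := Subtype.ext hq
    have h1 : ((-q.num : ℤ) : 𝓞 K) + (q.den : ℤ) * ω + (0 : ℤ) * θ = 0 := by
      apply RingOfIntegers.coe_injective
      simp only [map_add, map_mul, map_intCast, map_zero, ← hq', Int.cast_zero, zero_mul, add_zero]
      have h2 : ((-q.num : ℤ) : ℚ) + ((q.den : ℤ) : ℚ) * q = 0 := by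
        push_cast
        linarith [Rat.den_mul_eq_num q]
      simpa only [map_add, map_mul, map_intCast, map_zero] using congrArg (algebraMap ℚ K) h2
    have := (h.indep _ _ _ h1).2.1
    simp at this
  · rw [discrOf, dif_pos hfd]
    exact hle

theorem ncard_cubicFields_le {s : ℝ} (hs : 1 < s) : ∃ C > 0, ∀ Y : ℝ, 0 < Y →
    {K : IntermediateField ℚ Qbar | Module.finrank ℚ K = 3 ∧ |(discrOf K : ℝ)| ≤ Y}.Finite ∧
    ({K : IntermediateField ℚ Qbar | Module.finrank ℚ K = 3 ∧
      |(discrOf K : ℝ)| ≤ Y}.ncard : ℝ) ≤ C * Y ^ s := by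
  obtain ⟨C, hC, h⟩ := ncard_intWeight_prod_le hs
  refine ⟨3 * (C * (9 * 7 ^ 3) ^ s), by positivity, fun Y hY => ?_⟩
  obtain ⟨hfin, hcard⟩ := h (9 * 7 ^ 3 * Y) (by positivity)
  rw [Set.ncard_eq_toFinset_card _ hfin] at hcard
  let F : Finset (IntermediateField ℚ Qbar) := hfin.toFinset.biUnion fun v =>
    (indexFormCharpoly v).roots.toFinset.image fun α => IntermediateField.adjoin ℚ {α}
  have hsub : {K : IntermediateField ℚ Qbar | Module.finrank ℚ K = 3 ∧ |(discrOf K : ℝ)| ≤ Y} ⊆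
      (F : Set (IntermediateField ℚ Qbar)) := by
    rintro K ⟨hK, hd⟩
    obtain ⟨v, α, hα, rfl, hle⟩ := exists_eq_adjoin_root_indexFormCharpoly hK
    rw [Finset.mem_coe, Finset.mem_biUnion]
    refine ⟨v, ?_, Finset.mem_image.mpr ⟨α, Multiset.mem_toFinset.mpr hα, rfl⟩⟩
    rw [Set.Finite.mem_toFinset, Set.mem_ofPred_eq]
    exact hle.trans (by gcongr)
  have hF : F.card ≤ hfin.toFinset.card * 3 := by
    refine Finset.card_biUnion_le_card_mul _ _ _ fun v _ => Finset.card_image_le.trans ?_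
    exact (Multiset.toFinset_card_le _).trans
      ((Polynomial.card_roots' _).trans (natDegree_indexFormCharpoly v).le)
  refine ⟨F.finite_toSet.subset hsub, ?_⟩
  calc _ ≤ (F.card : ℝ) := by
        have := Set.ncard_le_ncard hsub F.finite_toSet
        rw [Set.ncard_coe_finset] at this
        exact_mod_cast this
    _ ≤ hfin.toFinset.card * 3 := by exact_mod_cast hF
    _ ≤ (C * (9 * 7 ^ 3 * Y) ^ s) * 3 := by gcongr
    _ = _ := by rw [Real.mul_rpow (by positivity) hY.le]; ring

theorem le_rpow_of_pow_three_dvd_mul {a b g : ℕ} (ha : 0 < a) (hb : Squarefree b)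
    (hab : Nat.gcd a b = 1) (hg : g ^ 3 ∣ a * b) : (g : ℝ) ≤ (a : ℝ) ^ ((1 : ℝ) / 3) := by
  have hcop : Nat.Coprime g b := by
    by_contra h
    obtain ⟨p, hp, hpg, hpb⟩ := Nat.Prime.not_coprime_iff_dvd.mp h
    have hpa : Nat.Coprime p a := by
      rw [Nat.Prime.coprime_iff_not_dvd hp]
      exact fun hpa => hp.one_lt.ne' (Nat.dvd_one.mp (hab ▸ Nat.dvd_gcd hpa hpb))
    have h3 : p ^ 3 ∣ b :=
      (Nat.Coprime.pow_left 3 hpa).dvd_of_dvd_mul_left ((pow_dvd_pow_of_dvd hpg 3).trans hg)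
    have h2 : p * p ∣ b := (Dvd.intro _ (by ring : p * p * p = p ^ 3)).trans h3
    exact hp.one_lt.ne' (Nat.isUnit_iff.mp (hb p h2))
  have hga : g ^ 3 ≤ a :=
    Nat.le_of_dvd ha ((Nat.Coprime.pow_left 3 hcop).dvd_of_dvd_mul_right hg)
  calc (g : ℝ) = ((g : ℝ) ^ 3) ^ ((1 : ℝ) / 3) := by
        have := Real.pow_rpow_inv_natCast (Nat.cast_nonneg g : (0 : ℝ) ≤ g) three_ne_zero
        rw [one_div]
        exact_mod_cast this.symm
    _ ≤ (a : ℝ) ^ ((1 : ℝ) / 3) := by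
        gcongr
        exact_mod_cast hga

theorem Nat.card_sigma_subtype_le {α : Type*} {β : α → Type*} (P : (Σ i, β i) → Prop) {S : Set α}
    (hS : S.Finite) (Q : ∀ i, β i → Prop) {M : ℕ} (hP : ∀ x, P x → x.1 ∈ S ∧ Q x.1 x.2)
    (hQ : ∀ i ∈ S, Finite {y // Q i y} ∧ Nat.card {y // Q i y} ≤ M) :
    Nat.card {x // P x} ≤ S.ncard * M := by
  have : Fintype S := hS.fintype
  have : ∀ i : S, Finite {y // Q i y} := fun i => (hQ i i.2).1
  let F : {x // P x} → Σ i : S, {y // Q i y} := fun x =>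
    ⟨⟨x.1.1, (hP x.1 x.2).1⟩, ⟨x.1.2, (hP x.1 x.2).2⟩⟩
  have hF : Function.Injective F := by
    rintro ⟨⟨i, y⟩, hx⟩ ⟨⟨j, z⟩, hx'⟩ h
    simp only [F, Sigma.mk.injEq, Subtype.mk.injEq] at h
    obtain ⟨rfl, h⟩ := h
    simp only [heq_eq_eq, Subtype.mk.injEq] at h
    subst h
    rfl
  calc Nat.card {x // P x} ≤ Nat.card (Σ i : S, {y // Q i y}) := Nat.card_le_card_of_injective F hF
    _ = ∑ i : S, Nat.card {y // Q i y} := Nat.card_sigma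
    _ ≤ ∑ _i : S, M := Finset.sum_le_sum fun i _ => (hQ i i.2).2
    _ = S.ncard * M := by
        rw [Finset.sum_const, Finset.card_univ, smul_eq_mul, ← Nat.card_eq_fintype_card]
        rfl

/-- Uniform count of pairs `(K,R)` where `K` is a cubic field and `R ⊆ O_K` is an order
of additive index exactly `n = ab` (`a` powerful, `b` squarefree, coprime) with
`n²·|Δ(K)| < X`: there are at most `O_ε(X^{1+ε}/(a^{5/3}b²))` of them. -/
theorem count_orders_of_fixed_index :
    ∀ ε > (0 : ℝ), ∃ C > (0 : ℝ), ∀ X : ℝ, 1 ≤ X →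
      ∀ n a b : ℕ, 0 < n → n = a * b → IsPowerful a → Squarefree b →
        Nat.gcd a b = 1 →
        (Nat.card {x : Σ K : IntermediateField ℚ Qbar,
            Subring (NumberField.RingOfIntegers ↥K) //
              Module.finrank ℚ ↥x.1 = 3 ∧
              x.2.toAddSubgroup.index = n ∧
              (n : ℝ) ^ 2 * |(discrOf x.1 : ℝ)| < X} : ℝ) ≤
          C * X ^ (1 + ε) / ((a : ℝ) ^ ((5 : ℝ) / 3) * (b : ℝ) ^ 2) := by
  intro ε hε
  obtain ⟨C₁, hC₁, hfields⟩ := ncard_cubicFields_le (s := 1 + ε) (by linarith)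
  obtain ⟨C₂, hC₂, hdiv⟩ := card_divisors_le_mul_rpow (ε := 2 * ε / 5) (by positivity)
  refine ⟨C₁ * C₂ ^ 5, by positivity, ?_⟩
  intro X hX n a b hn hnab _ hb hab
  have ha0 : 0 < a := Nat.pos_of_ne_zero (by rintro rfl; simp [hnab] at hn)
  have hb0 : 0 < b := Nat.pos_of_ne_zero (by rintro rfl; simp [hnab] at hn)
  have hX0 : 0 < X := by linarith
  have hn0 : (0 : ℝ) < n := by exact_mod_cast hn
  have ha0' : (0 : ℝ) < a := by exact_mod_cast ha0
  have hb0' : (0 : ℝ) < b := by exact_mod_cast hb0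
  obtain ⟨hfin, hcard⟩ := hfields (X / n ^ 2) (by positivity)
  set G : ℕ := ⌊(a : ℝ) ^ ((1 : ℝ) / 3)⌋₊
  have hG : ∀ g, g ^ 3 ∣ n → g ≤ G := fun g hg =>
    Nat.le_floor (le_rpow_of_pow_three_dvd_mul ha0 hb hab (hnab ▸ hg))
  have hmain := Nat.card_sigma_subtype_le
    (fun x : Σ K : IntermediateField ℚ Qbar, Subring (NumberField.RingOfIntegers ↥K) =>
      Module.finrank ℚ ↥x.1 = 3 ∧ x.2.toAddSubgroup.index = n ∧
        (n : ℝ) ^ 2 * |(discrOf x.1 : ℝ)| < X) hfin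
    (fun _ R => R.toAddSubgroup.index = n) (M := n.divisors.card ^ 5 * G)
    (fun x hx => ⟨⟨hx.1, by
      rw [le_div_iff₀ (by positivity), mul_comm]
      exact hx.2.2.le⟩, hx.2.1⟩)
    (fun K hK => by
      have hfd : FiniteDimensional ℚ K := Module.finite_of_finrank_pos (by rw [hK.1]; norm_num)
      obtain ⟨ω, θ, a', b', c', d', h, -⟩ := exists_isCubicRingBasis_intWeight_le K hK.1
      exact h.card_subring_le (isClosedUnderDivision_ringOfIntegers K) hn hG)
  have hX' : (X / n ^ 2) ^ (1 + ε) * ((n : ℝ) ^ (2 * ε / 5)) ^ 5 = X ^ (1 + ε) / n ^ 2 := by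
    rw [Real.div_rpow hX0.le (by positivity), ← Real.rpow_natCast (n : ℝ) 2, ← Real.rpow_mul hn0.le,
      ← Real.rpow_natCast _ 5, ← Real.rpow_mul hn0.le, div_mul_eq_mul_div, mul_div_assoc,
      ← Real.rpow_sub hn0, div_eq_mul_inv _ ((n : ℝ) ^ ((2 : ℕ) : ℝ)), ← Real.rpow_neg hn0.le]
    congr 2
    push_cast
    ring
  have ha' : (a : ℝ) ^ ((1 : ℝ) / 3) * (a : ℝ) ^ ((5 : ℝ) / 3) = a ^ 2 := by
    rw [← Real.rpow_add ha0', ← Real.rpow_natCast]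
    norm_num
  calc _ ≤ ((_ * (n.divisors.card ^ 5 * G) : ℕ) : ℝ) := by exact_mod_cast hmain
    _ ≤ (C₁ * (X / n ^ 2) ^ (1 + ε)) * ((C₂ * (n : ℝ) ^ (2 * ε / 5)) ^ 5 *
        (a : ℝ) ^ ((1 : ℝ) / 3)) := by
      push_cast
      gcongr
      · exact hdiv n hn
      · exact Nat.floor_le (by positivity)
    _ = (C₁ * C₂ ^ 5) * ((X / n ^ 2) ^ (1 + ε) * ((n : ℝ) ^ (2 * ε / 5)) ^ 5) *
        (a : ℝ) ^ ((1 : ℝ) / 3) := by ring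
    _ = (C₁ * C₂ ^ 5) * X ^ (1 + ε) / ((a : ℝ) ^ ((5 : ℝ) / 3) * (b : ℝ) ^ 2) := by
      rw [hX', hnab]
      push_cast
      rw [mul_pow, ← ha']
      have : (0 : ℝ) < (a : ℝ) ^ ((1 : ℝ) / 3) := by positivity
      field_simp
end
end

section
/- For every ε > 0 there exists a constant C = C(ε), independent of K and Z, such that for every cubic field K and every real Z ≥ 1, the number of subrings R ⊆ O_K of finite additive index [O_K : R] ≤ Z is at most C·Z^{1+ε}·|Δ(K)|^ε. -/
open scoped Classical
noncomputable section

/-- The divisor bound: the number of divisors of `n` is `O_ε(n ^ ε)`. -/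
theorem exists_card_divisors_le_mul_rpow {ε : ℝ} (hε : 0 < ε) :
    ∃ C : ℝ, 1 ≤ C ∧ ∀ n : ℕ, n ≠ 0 → (n.divisors.card : ℝ) ≤ C * (n : ℝ) ^ ε := by
  have hlog : 0 < Real.log 2 := Real.log_pos one_lt_two
  set A : ℝ := 1 + 1 / (ε * Real.log 2) with hA
  have hA1 : 1 ≤ A := by rw [hA]; have : 0 < 1 / (ε * Real.log 2) := by positivity
                         linarith
  obtain ⟨P, hP⟩ := exists_nat_ge ((2 : ℝ) ^ (1 / ε))
  refine ⟨A ^ P, one_le_pow₀ hA1, fun n hn => ?_⟩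
  have local_bound : ∀ p ∈ n.primeFactors, ((n.factorization p + 1 : ℕ) : ℝ) ≤
      (if p < P then A else 1) * ((p : ℝ) ^ n.factorization p) ^ ε := by
    intro p hp
    have hp2 : (2 : ℝ) ≤ p := by exact_mod_cast (Nat.prime_of_mem_primeFactors hp).two_le
    set k := n.factorization p
    have hswap : ((p : ℝ) ^ k) ^ ε = ((p : ℝ) ^ ε) ^ k := by
      rw [← Real.rpow_natCast, ← Real.rpow_natCast, ← Real.rpow_mul (by linarith),
        ← Real.rpow_mul (by linarith), mul_comm]
    split_ifs with h
    · have h1 : ((2 : ℝ) ^ ε) ^ k ≤ ((p : ℝ) ^ ε) ^ k := by gcongr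
      have h2 : 1 + k * (ε * Real.log 2) ≤ ((2 : ℝ) ^ ε) ^ k := by
        rw [Real.rpow_def_of_pos two_pos, ← Real.exp_nat_mul]
        have := Real.add_one_le_exp ((k : ℝ) * (Real.log 2 * ε))
        linarith
      have h3 : (k : ℝ) + 1 ≤ A * (1 + k * (ε * Real.log 2)) := by
        have : A * (1 + k * (ε * Real.log 2)) =
            k + 1 + (k * (ε * Real.log 2) + 1 / (ε * Real.log 2)) := by
          rw [hA]; field_simp; ring
        rw [this]
        have : 0 ≤ k * (ε * Real.log 2) + 1 / (ε * Real.log 2) := by positivity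
        linarith
      rw [hswap]
      push_cast
      exact h3.trans (by gcongr; exact h2.trans h1)
    · have hpε : (2 : ℝ) ≤ (p : ℝ) ^ ε := by
        have : (2 : ℝ) ^ (1 / ε) ≤ p := hP.trans (by exact_mod_cast not_lt.mp h)
        calc (2 : ℝ) = ((2 : ℝ) ^ (1 / ε)) ^ ε := by
              rw [← Real.rpow_mul two_pos.le, one_div_mul_cancel hε.ne', Real.rpow_one]
          _ ≤ _ := by gcongr
      rw [hswap, one_mul]
      calc ((k + 1 : ℕ) : ℝ) ≤ ((2 ^ k : ℕ) : ℝ) := by exact_mod_cast Nat.lt_two_pow_self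
        _ = 2 ^ k := by push_cast; rfl
        _ ≤ _ := by gcongr
  calc (n.divisors.card : ℝ) = ∏ p ∈ n.primeFactors, ((n.factorization p + 1 : ℕ) : ℝ) := by
        rw [Nat.card_divisors hn]; push_cast; rfl
    _ ≤ ∏ p ∈ n.primeFactors,
        ((if p < P then A else 1) * ((p : ℝ) ^ n.factorization p) ^ ε) :=
      Finset.prod_le_prod (fun _ _ => by positivity) local_bound
    _ = (∏ p ∈ n.primeFactors, if p < P then A else 1) * (n : ℝ) ^ ε := by
      rw [Finset.prod_mul_distrib, Real.finsetProd_rpow _ _ (fun _ _ => by positivity)]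
      congr 2
      conv_rhs => rw [← Nat.prod_factorization_pow_eq_self hn]
      simp [Finsupp.prod]
    _ ≤ A ^ P * (n : ℝ) ^ ε := by
      gcongr
      rw [Finset.prod_ite, Finset.prod_const, Finset.prod_const_one, mul_one]
      refine pow_le_pow_right₀ hA1 ?_
      calc _ ≤ (Finset.range P).card := Finset.card_le_card fun p hp => by
            simpa using (Finset.mem_filter.mp hp).2
        _ = P := Finset.card_range P

section DivisorCount

variable {M : Type*} [CommMonoidWithZero M]

/-- `HasAtMostDivisors a c` says that `a` has at most `c` divisors. -/
def HasAtMostDivisors (a : M) (c : ℕ) : Prop :=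
  ∃ s : Finset M, s.card ≤ c ∧ ∀ d, d ∣ a → d ∈ s

theorem HasAtMostDivisors.mono {a : M} {c d : ℕ} (h : HasAtMostDivisors a c) (hcd : c ≤ d) :
    HasAtMostDivisors a d :=
  let ⟨s, hs, h⟩ := h
  ⟨s, hs.trans hcd, h⟩

theorem HasAtMostDivisors.mul [DecompositionMonoid M] {a b : M} {c d : ℕ}
    (ha : HasAtMostDivisors a c) (hb : HasAtMostDivisors b d) :
    HasAtMostDivisors (a * b) (c * d) := by
  obtain ⟨s, hs, hsa⟩ := ha
  obtain ⟨t, ht, htb⟩ := hb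
  refine ⟨Finset.image₂ (· * ·) s t,
    (Finset.card_image₂_le _ _ _).trans (Nat.mul_le_mul hs ht), fun x hx => ?_⟩
  obtain ⟨y, z, hy, hz, rfl⟩ := exists_dvd_and_dvd_of_dvd_mul hx
  exact Finset.mem_image₂_of_mem (hsa y hy) (htb z hz)

theorem hasAtMostDivisors_one [Subsingleton Mˣ] : HasAtMostDivisors (1 : M) 1 :=
  ⟨{1}, by simp, fun d hd => by simpa using isUnit_iff_eq_one.mp (isUnit_of_dvd_one hd)⟩

theorem HasAtMostDivisors.prod [DecompositionMonoid M] [Subsingleton Mˣ] {ι : Type*}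
    (s : Finset ι) {f : ι → M} {c : ι → ℕ} (h : ∀ i ∈ s, HasAtMostDivisors (f i) (c i)) :
    HasAtMostDivisors (∏ i ∈ s, f i) (∏ i ∈ s, c i) := by
  induction s using Finset.induction_on with
  | empty => simpa using hasAtMostDivisors_one
  | insert a s ha ih =>
    rw [Finset.prod_insert ha, Finset.prod_insert ha]
    exact (h a (by simp)).mul (ih fun i hi => h i (by simp [hi]))

theorem Prime.hasAtMostDivisors_pow [IsCancelMulZero M] [Subsingleton Mˣ] {p : M} (hp : Prime p)
    (k : ℕ) : HasAtMostDivisors (p ^ k) (k + 1) := by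
  refine ⟨(Finset.range (k + 1)).image (p ^ ·), Finset.card_image_le.trans (by simp),
    fun d hd => ?_⟩
  obtain ⟨i, hi, h⟩ := (dvd_prime_pow hp k).mp hd
  exact Finset.mem_image.mpr ⟨i, by simpa [Nat.lt_succ_iff] using hi, (associated_iff_eq.mp h).symm⟩

theorem HasAtMostDivisors.multiset_prod_pow [DecompositionMonoid M] [IsCancelMulZero M]
    [Subsingleton Mˣ] (k : ℕ) (s : Multiset M) (hs : ∀ p ∈ s, Prime p) :
    HasAtMostDivisors (s.prod ^ k) ((k + 1) ^ s.card) := by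
  induction s using Multiset.induction_on with
  | empty => simpa using hasAtMostDivisors_one
  | cons p s ih =>
    rw [Multiset.prod_cons, Multiset.card_cons, pow_succ', mul_pow]
    exact ((hs p (by simp)).hasAtMostDivisors_pow k).mul (ih fun q hq => hs q (by simp [hq]))

end DivisorCount

section NumberField

open NumberField

variable {K : Type*} [Field K] [NumberField K]

theorem card_normalizedFactors_span_prime_le {p : ℕ} (hp : p.Prime) :
    (UniqueFactorizationMonoid.normalizedFactors (Ideal.span {(p : 𝓞 K)})).card ≤
      Module.finrank ℚ K := by
  have hne : Ideal.span {(p : 𝓞 K)} ≠ 0 := by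
    simpa using hp.ne_zero
  have hnorm : Ideal.absNorm (Ideal.span {(p : 𝓞 K)}) = p ^ Module.finrank ℚ K := by
    rw [← RingOfIntegers.rank K, ← Ideal.absNorm_span_natCast]
  have key : ∀ s : Multiset (Ideal (𝓞 K)), (∀ P ∈ s, Prime P) →
      s.prod ∣ Ideal.span {(p : 𝓞 K)} → p ^ s.card ∣ Ideal.absNorm s.prod := by
    intro s
    induction s using Multiset.induction_on with
    | empty => simp
    | cons P s ih =>
      intro hs hd
      rw [Multiset.prod_cons] at hd ⊢
      rw [Multiset.card_cons, pow_succ', map_mul]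
      refine mul_dvd_mul ?_ (ih (fun q hq => hs q (by simp [hq])) (dvd_of_mul_left_dvd hd))
      have h1 : Ideal.absNorm P ∣ p ^ Module.finrank ℚ K :=
        hnorm ▸ Ideal.absNorm_dvd_absNorm_of_le (Ideal.dvd_iff_le.mp (dvd_of_mul_right_dvd hd))
      obtain ⟨i, -, hi⟩ := (Nat.dvd_prime_pow hp).mp h1
      rw [hi]
      refine dvd_pow_self p fun h0 => (hs P (by simp)).not_isUnit ?_
      rw [h0, pow_zero, Ideal.absNorm_eq_one_iff] at hi
      simp [hi]
  have hprod : (UniqueFactorizationMonoid.normalizedFactors (Ideal.span {(p : 𝓞 K)})).prod =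
      Ideal.span {(p : 𝓞 K)} := Ideal.prod_normalizedFactors_eq_self hne
  have := key _ (fun P hP => UniqueFactorizationMonoid.prime_of_normalized_factor P hP)
    hprod.dvd
  rw [hprod, hnorm] at this
  exact (Nat.pow_dvd_pow_iff_le_right hp.one_lt).mp this

/-- The ideal `(n)` of a number field of degree `d` has at most `τ(n) ^ d` divisors. -/
theorem hasAtMostDivisors_span_natCast {n : ℕ} (hn : n ≠ 0) :
    HasAtMostDivisors (Ideal.span {(n : 𝓞 K)}) (n.divisors.card ^ Module.finrank ℚ K) := by
  have h1 : Ideal.span {(n : 𝓞 K)} =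
      ∏ p ∈ n.primeFactors, Ideal.span {(p : 𝓞 K)} ^ n.factorization p := by
    conv_lhs => rw [← Nat.prod_factorization_pow_eq_self hn]
    simp [Finsupp.prod, Ideal.span_singleton_pow, Ideal.prod_span_singleton]
  rw [h1, Nat.card_divisors hn, ← Finset.prod_pow]
  refine HasAtMostDivisors.prod _ fun p hp => ?_
  have hp' := Nat.prime_of_mem_primeFactors hp
  have hne : Ideal.span {(p : 𝓞 K)} ≠ 0 := by
    simpa using hp'.ne_zero
  have h := HasAtMostDivisors.multiset_prod_pow (n.factorization p)
    (UniqueFactorizationMonoid.normalizedFactors (Ideal.span {(p : 𝓞 K)}))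
    (fun P hP => UniqueFactorizationMonoid.prime_of_normalized_factor P hP)
  rw [Ideal.prod_normalizedFactors_eq_self hne] at h
  exact h.mono (Nat.pow_le_pow_right (Nat.succ_pos _) (card_normalizedFactors_span_prime_le hp'))

end NumberField

theorem Int.exists_natCast_dvd_iff_mem (D : AddSubgroup ℤ) {g : ℕ} (hg : (g : ℤ) ∈ D) :
    ∃ d : ℕ, d ∣ g ∧ ∀ k : ℤ, k ∈ D ↔ (d : ℤ) ∣ k := by
  obtain ⟨a, ha⟩ := Int.subgroup_cyclic D
  have h : ∀ k : ℤ, k ∈ D ↔ ((a.natAbs : ℕ) : ℤ) ∣ k := fun k => by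
    rw [ha, ← AddSubgroup.zmultiples_eq_closure, Int.mem_zmultiples_iff, Int.natCast_natAbs,
      abs_dvd]
  exact ⟨a.natAbs, Int.natCast_dvd_natCast.mp ((h _).mp hg), h⟩

section CommRing

variable {A : Type*} [CommRing A]

/-- Additive subgroups `H ≤ T` containing `1` and `g • T`, when `T` is spanned by `1` and two
further elements. -/
def boundedSubgroups (g : ℕ) (T : AddSubgroup A) : Set (AddSubgroup A) :=
  {H | (1 : A) ∈ H ∧ H ≤ T ∧ (∀ z ∈ T, (g : A) * z ∈ H) ∧
    ∃ x ∈ T, ∃ y ∈ T, ∀ z ∈ T, ∃ i k l : ℤ, z = i + k * x + l * y}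

/-- The triple `(e, d, t)` describes `H` in Hermite normal form with respect to `1, x, y`. -/
def IsHermiteData (x y : A) (H : AddSubgroup A) (p : ℕ × ℕ × ℕ) : Prop :=
  (∀ k : ℤ, (k : A) * y ∈ H ↔ (p.2.1 : ℤ) ∣ k) ∧
  (∀ k : ℤ, (∃ l : ℤ, (k : A) * x + l * y ∈ H) ↔ (p.1 : ℤ) ∣ k) ∧
  (p.1 : A) * x + p.2.2 * y ∈ H

theorem intCast_mul_mem {H : AddSubgroup A} {z : A} (hz : z ∈ H) (k : ℤ) : (k : A) * z ∈ H := by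
  simpa [zsmul_eq_mul] using H.zsmul_mem hz k

theorem intCast_mem_of_one_mem {H : AddSubgroup A} (h : (1 : A) ∈ H) (k : ℤ) : (k : A) ∈ H := by
  simpa using intCast_mul_mem h k

theorem IsHermiteData.le {x y : A} {T H H' : AddSubgroup A} {p : ℕ × ℕ × ℕ}
    (hT : ∀ z ∈ T, ∃ i k l : ℤ, z = i + k * x + l * y) (hH : H ≤ T) (h1 : (1 : A) ∈ H)
    (h1' : (1 : A) ∈ H') (h : IsHermiteData x y H p) (h' : IsHermiteData x y H' p) : H ≤ H' := by
  intro z hz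
  obtain ⟨i, k, l, rfl⟩ := hT z (hH hz)
  have hkl : (k : A) * x + l * y ∈ H := by
    have := H.sub_mem hz (intCast_mem_of_one_mem h1 i)
    rwa [add_assoc, add_sub_cancel_left] at this
  obtain ⟨m, rfl⟩ := (h.2.1 k).mp ⟨l, hkl⟩
  have hl : ((l - m * p.2.2 : ℤ) : A) * y ∈ H := by
    have := H.sub_mem hkl (intCast_mul_mem h.2.2 m)
    convert this using 1
    push_cast; ring
  have hl' := (h'.1 _).mpr ((h.1 _).mp hl)
  have := H'.add_mem (H'.add_mem (intCast_mem_of_one_mem h1' i) (intCast_mul_mem h'.2.2 m)) hl'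
  convert this using 1
  push_cast; ring

theorem exists_isHermiteData {g : ℕ} (hg : g ≠ 0) {x y : A} {H : AddSubgroup A}
    (hx : (g : A) * x ∈ H) (hy : (g : A) * y ∈ H) :
    ∃ p ∈ g.divisors ×ˢ g.divisors ×ˢ Finset.range g, IsHermiteData x y H p := by
  let D : AddSubgroup ℤ :=
    { carrier := {k | (k : A) * y ∈ H}
      zero_mem' := by simp
      add_mem' := fun {a b} ha hb => by
        have := H.add_mem ha hb
        rw [← add_mul] at this
        simpa using this
      neg_mem' := fun {a} ha => by
        have := H.neg_mem ha
        simpa using this }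
  let E : AddSubgroup ℤ :=
    { carrier := {k | ∃ l : ℤ, (k : A) * x + l * y ∈ H}
      zero_mem' := ⟨0, by simp⟩
      add_mem' := by
        rintro a b ⟨l, hl⟩ ⟨m, hm⟩
        refine ⟨l + m, ?_⟩
        convert H.add_mem hl hm using 1
        push_cast; ring
      neg_mem' := by
        rintro a ⟨l, hl⟩
        refine ⟨-l, ?_⟩
        convert H.neg_mem hl using 1
        push_cast; ring }
  obtain ⟨d, hdg, hd⟩ := Int.exists_natCast_dvd_iff_mem D (g := g)
    (show ((g : ℤ) : A) * y ∈ H by simpa using hy)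
  obtain ⟨e, heg, he⟩ := Int.exists_natCast_dvd_iff_mem E (g := g)
    (show ∃ l : ℤ, ((g : ℤ) : A) * x + l * y ∈ H from ⟨0, by simpa using hx⟩)
  obtain ⟨l, hl⟩ : ∃ l : ℤ, ((e : ℤ) : A) * x + l * y ∈ H := (he e).mpr dvd_rfl
  have hg' : (0 : ℤ) < g := by positivity
  refine ⟨(e, d, (l % g).toNat), ?_, hd, he, ?_⟩
  · simp only [Finset.mem_product, Nat.mem_divisors, Finset.mem_range]
    refine ⟨⟨heg, hg⟩, ⟨hdg, hg⟩, ?_⟩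
    have := Int.emod_lt_of_pos l hg'
    have := Int.emod_nonneg l hg'.ne'
    lia
  · have h1 : (((l % g).toNat : ℕ) : A) = ((l % g : ℤ) : A) := by
      rw [← Int.cast_natCast, Int.toNat_of_nonneg (Int.emod_nonneg l hg'.ne')]
    have h2 : ((l % g : ℤ) : A) = l - g * ((l / g : ℤ) : A) := by
      rw [Int.emod_def]; push_cast; ring
    change (e : A) * x + (((l % g).toNat : ℕ) : A) * y ∈ H
    rw [h1, h2]
    convert H.sub_mem hl (intCast_mul_mem hy (l / g)) using 1
    push_cast; ring

theorem exists_finset_boundedSubgroups (g : ℕ) (hg : g ≠ 0) (T : AddSubgroup A) :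
    ∃ s : Finset (AddSubgroup A), s.card ≤ g.divisors.card ^ 2 * g ∧
      ∀ H ∈ boundedSubgroups g T, H ∈ s := by
  by_cases hT : ∃ x ∈ T, ∃ y ∈ T, ∀ z ∈ T, ∃ i k l : ℤ, z = i + k * x + l * y
  swap
  · exact ⟨∅, by simp, fun H hH => (hT hH.2.2.2).elim⟩
  obtain ⟨x, hx, y, hy, hT⟩ := hT
  let φ : ℕ × ℕ × ℕ → AddSubgroup A := fun p =>
    if h : ∃ H ≤ T, (1 : A) ∈ H ∧ IsHermiteData x y H p then h.choose else ⊥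
  refine ⟨(g.divisors ×ˢ g.divisors ×ˢ Finset.range g).image φ,
    Finset.card_image_le.trans (by simp [sq, mul_assoc]), ?_⟩
  rintro H ⟨h1, hHT, hgT, -⟩
  obtain ⟨p, hp, hHp⟩ := exists_isHermiteData hg (hgT x hx) (hgT y hy)
  have h : ∃ H ≤ T, (1 : A) ∈ H ∧ IsHermiteData x y H p := ⟨H, hHT, h1, hHp⟩
  refine Finset.mem_image.mpr ⟨p, hp, ?_⟩
  obtain ⟨h2, h3, h4⟩ := h.choose_spec
  simp only [φ, dif_pos h]
  exact le_antisymm (h4.le hT h2 h3 h1 hHp) (hHp.le hT hHT h1 h3 h4)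

/-- The additive group `ℤ + b F`. -/
def intAddSMulIdeal (b : ℕ) (F : Ideal A) : AddSubgroup A where
  carrier := {z | ∃ r : ℤ, ∃ f ∈ F, z = r + b * f}
  zero_mem' := ⟨0, 0, F.zero_mem, by simp⟩
  add_mem' := by
    rintro _ _ ⟨r, f, hf, rfl⟩ ⟨r', f', hf', rfl⟩
    exact ⟨r + r', f + f', F.add_mem hf hf', by push_cast; ring⟩
  neg_mem' := by
    rintro _ ⟨r, f, hf, rfl⟩
    exact ⟨-r, -f, F.neg_mem hf, by push_cast; ring⟩

theorem mem_intAddSMulIdeal {b : ℕ} {F : Ideal A} {z : A} :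
    z ∈ intAddSMulIdeal b F ↔ ∃ r : ℤ, ∃ f ∈ F, z = r + b * f :=
  Iff.rfl

end CommRing

theorem Nat.div_gcd_dvd_of_dvd_sq_mul {b s t : ℕ} (hb : b ≠ 0) (ht : t ≠ 0) (hst : s.Coprime t)
    {q : ℤ} (h : ((b * t : ℕ) : ℤ) ∣ ((b * s : ℕ) : ℤ) ^ 2 * q) : ((t / t.gcd b : ℕ) : ℤ) ∣ q := by
  have hb' : (b : ℤ) ≠ 0 := by exact_mod_cast hb
  have h1 : (t : ℤ) ∣ (s : ℤ) ^ 2 * (b * q) := by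
    refine (mul_dvd_mul_iff_left hb').mp ?_
    have e : (b : ℤ) * (s ^ 2 * (b * q)) = ((b * s : ℕ) : ℤ) ^ 2 * q := by push_cast; ring
    rwa [e, ← Nat.cast_mul]
  have h2 : (t : ℤ) ∣ b * q :=
    ((Nat.isCoprime_iff_coprime.mpr hst.symm).pow_right (n := 2)).dvd_of_dvd_mul_left h1
  obtain ⟨g, t', b', hg, hcop, h3, h4⟩ := Nat.exists_coprime' (Nat.gcd_pos_of_pos_left b
    (Nat.pos_of_ne_zero ht))
  have hgt : t / t.gcd b = t' := by
    have hgg : t.gcd b = g := by rw [h3, h4, Nat.gcd_mul_right, hcop.gcd_eq_one, one_mul]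
    rw [hgg]; exact Nat.div_eq_of_eq_mul_left hg h3
  rw [hgt]
  have hg' : (g : ℤ) ≠ 0 := by exact_mod_cast hg.ne'
  have h5 : (t' : ℤ) ∣ b' * q := by
    refine (mul_dvd_mul_iff_left hg').mp ?_
    have e : (g : ℤ) * (b' * q) = b * q := by rw [h4]; push_cast; ring
    have e' : (g : ℤ) * t' = t := by rw [h3]; push_cast; ring
    rwa [e, e']
  exact (Nat.isCoprime_iff_coprime.mpr hcop).dvd_of_dvd_mul_left h5

theorem Int.exists_dvd_sub_and_dvd_sub {s t : ℤ} (h : IsCoprime s t) (j k : ℤ) :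
    ∃ r : ℤ, s ∣ j - r ∧ t ∣ k - r := by
  obtain ⟨u, v, huv⟩ := h
  refine ⟨k * (u * s) + j * (v * t), ⟨(j - k) * u, ?_⟩, ⟨(k - j) * v, ?_⟩⟩
  · linear_combination (-j) * huv
  · linear_combination (-k) * huv

section AdaptedBasis

variable {A : Type*} [CommRing A]

theorem AddMonoidHom.map_intCast_mul (c : A →+ ℤ) (k : ℤ) (x : A) : c (k * x) = k * c x := by
  rw [← zsmul_eq_mul, map_zsmul, smul_eq_mul]

theorem AddMonoidHom.map_natCast_mul (c : A →+ ℤ) (k : ℕ) (x : A) : c (k * x) = k * c x := by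
  rw [← nsmul_eq_mul, map_nsmul, nsmul_eq_mul]

/-- `1, ω, θ` is a `ℤ`-basis of `A`, and `c₁, c₂` are the coordinates along `ω` and `θ`. -/
structure IsCubicBasis (ω θ : A) (c₁ c₂ : A →+ ℤ) : Prop where
  fst_one : c₁ 1 = 0
  snd_one : c₂ 1 = 0
  fst_fst : c₁ ω = 1
  snd_fst : c₂ ω = 0
  fst_snd : c₁ θ = 0
  snd_snd : c₂ θ = 1
  exists_eq : ∀ x, ∃ i : ℤ, x = i + c₁ x * ω + c₂ x * θ

namespace IsCubicBasis

variable {ω θ : A} {c₁ c₂ : A →+ ℤ}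

theorem symm (h : IsCubicBasis ω θ c₁ c₂) : IsCubicBasis θ ω c₂ c₁ :=
  ⟨h.snd_one, h.fst_one, h.snd_snd, h.fst_snd, h.snd_fst, h.fst_fst, fun x => by
    obtain ⟨i, hi⟩ := h.exists_eq x
    exact ⟨i, by rw [add_right_comm]; exact hi⟩⟩

theorem fst_intCast (h : IsCubicBasis ω θ c₁ c₂) (k : ℤ) : c₁ k = 0 := by
  simpa [h.fst_one] using c₁.map_intCast_mul k 1

theorem snd_intCast (h : IsCubicBasis ω θ c₁ c₂) (k : ℤ) : c₂ k = 0 := h.symm.fst_intCast k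

theorem fst_combination (h : IsCubicBasis ω θ c₁ c₂) (i j k : ℤ) :
    c₁ (i + j * ω + k * θ) = j := by
  simp [h.fst_intCast, c₁.map_intCast_mul, h.fst_fst, h.fst_snd]

theorem snd_combination (h : IsCubicBasis ω θ c₁ c₂) (i j k : ℤ) :
    c₂ (i + j * ω + k * θ) = k := by
  simp [h.snd_intCast, c₂.map_intCast_mul, h.snd_fst, h.snd_snd]

theorem dvd_fst_mul (h : IsCubicBasis ω θ c₁ c₂) {s : ℤ} (hs : s ∣ c₁ (θ * θ)) {x y : A}
    (hx : s ∣ c₁ x) (hy : s ∣ c₁ y) : s ∣ c₁ (x * y) := by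
  obtain ⟨i, hi⟩ := h.exists_eq x
  obtain ⟨i', hi'⟩ := h.exists_eq y
  obtain ⟨j, hj⟩ := hx
  obtain ⟨j', hj'⟩ := hy
  obtain ⟨p, hp⟩ := hs
  generalize c₂ x = k at hi
  generalize c₂ y = k' at hi'
  rw [hj] at hi
  rw [hj'] at hi'
  have : x * y = ((i * i' : ℤ) : A) + ((i * (s * j') + i' * (s * j) : ℤ) : A) * ω +
      ((i * k' + i' * k : ℤ) : A) * θ + ((s * j * (s * j') : ℤ) : A) * (ω * ω) +
      ((s * j * k' + s * j' * k : ℤ) : A) * (ω * θ) + ((k * k' : ℤ) : A) * (θ * θ) := by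
    rw [hi, hi']; push_cast; ring
  rw [this]
  simp only [map_add, h.fst_intCast, c₁.map_intCast_mul, h.fst_fst, h.fst_snd, hp]
  exact ⟨i * j' + i' * j + j * (s * j') * c₁ (ω * ω) + (j * k' + j' * k) * c₁ (ω * θ) +
    k * k' * p, by ring⟩

theorem dvd_snd_mul (h : IsCubicBasis ω θ c₁ c₂) {t : ℤ} (ht : t ∣ c₂ (ω * ω)) {x y : A}
    (hx : t ∣ c₂ x) (hy : t ∣ c₂ y) : t ∣ c₂ (x * y) :=
  h.symm.dvd_fst_mul ht hx hy

/-- If `s, t` are coprime and `{x | s ∣ c₁ x ∧ t ∣ c₂ x}` is a ring, it is of the form `ℤ + F`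
for an ideal `F` of `A` containing `st`. -/
theorem exists_ideal (h : IsCubicBasis ω θ c₁ c₂) {s t : ℤ} (hst : IsCoprime s t)
    (hs : s ∣ c₁ (θ * θ)) (ht : t ∣ c₂ (ω * ω)) :
    ∃ F : Ideal A, ((s * t : ℤ) : A) ∈ F ∧
      ∀ x, (∃ r : ℤ, ∃ f ∈ F, x = r + f) ↔ s ∣ c₁ x ∧ t ∣ c₂ x := by
  let F : Ideal A :=
    { carrier := {x | ∀ y, s ∣ c₁ (x * y) ∧ t ∣ c₂ (x * y)}
      zero_mem' := by simp
      add_mem' := fun {a b} ha hb y => by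
        simp only [add_mul, map_add]
        exact ⟨dvd_add (ha y).1 (hb y).1, dvd_add (ha y).2 (hb y).2⟩
      smul_mem' := fun a x hx y => by
        have := hx (a * y)
        rwa [smul_eq_mul, mul_comm a x, mul_assoc] }
  have approx : ∀ y : A, ∃ l : ℤ, s ∣ c₁ (y - l * (ω + θ)) ∧ t ∣ c₂ (y - l * (ω + θ)) := by
    intro y
    obtain ⟨l, h1, h2⟩ := Int.exists_dvd_sub_and_dvd_sub hst (c₁ y) (c₂ y)
    refine ⟨l, ?_, ?_⟩
    · simpa [c₁.map_intCast_mul, h.fst_fst, h.fst_snd] using h1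
    · simpa [c₂.map_intCast_mul, h.snd_fst, h.snd_snd] using h2
  refine ⟨F, fun y => ?_, fun x => ⟨?_, ?_⟩⟩
  · rw [c₁.map_intCast_mul, c₂.map_intCast_mul]
    exact ⟨⟨t * c₁ y, by ring⟩, ⟨s * c₂ y, by ring⟩⟩
  · rintro ⟨r, f, hf, rfl⟩
    have := hf 1
    rw [mul_one] at this
    rwa [map_add, map_add, h.fst_intCast, h.snd_intCast, zero_add, zero_add]
  · rintro ⟨hx1, hx2⟩
    obtain ⟨r, hr1, hr2⟩ := approx (x * (ω + θ))
    rw [← sub_mul] at hr1 hr2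
    have hxr1 : s ∣ c₁ (x - r) := by rwa [map_sub, h.fst_intCast, sub_zero]
    have hxr2 : t ∣ c₂ (x - r) := by rwa [map_sub, h.snd_intCast, sub_zero]
    refine ⟨r, x - r, fun y => ?_, by ring⟩
    obtain ⟨l, hl1, hl2⟩ := approx y
    have hy : (x - r) * y = (x - r) * (y - l * (ω + θ)) + l * ((x - r) * (ω + θ)) := by ring
    rw [hy, map_add, map_add, c₁.map_intCast_mul, c₂.map_intCast_mul]
    exact ⟨dvd_add (h.dvd_fst_mul hs hxr1 hl1) (hr1.mul_left l),
      dvd_add (h.dvd_snd_mul ht hxr2 hl2) (hr2.mul_left l)⟩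

theorem exists_mem_boundedSubgroups (h : IsCubicBasis ω θ c₁ c₂) {R : Subring A} {a₁ a₂ : ℕ}
    (ha₁ : a₁ ≠ 0) (ha₂ : a₂ ≠ 0)
    (hR : ∀ x, x ∈ R ↔ (a₁ : ℤ) ∣ c₁ x ∧ (a₂ : ℤ) ∣ c₂ x) :
    ∃ g b : ℕ, ∃ F : Ideal A, g ^ 3 ∣ a₁ * a₂ ∧ b ∣ a₁ * a₂ ∧ ((a₁ * a₂ : ℕ) : A) ∈ F ∧
      R.toAddSubgroup ∈ boundedSubgroups g (intAddSMulIdeal b F) := by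
  obtain ⟨b, s, t, hb, hst, rfl, rfl⟩ := Nat.exists_coprime' (Nat.gcd_pos_of_pos_left a₂
    (Nat.pos_of_ne_zero ha₁))
  rw [mul_comm s b, mul_comm t b] at *
  have hs0 : s ≠ 0 := right_ne_zero_of_mul ha₁
  have ht0 : t ≠ 0 := right_ne_zero_of_mul ha₂
  have hω : ((b * s : ℕ) : A) * ω ∈ R := by
    rw [hR, c₁.map_natCast_mul, c₂.map_natCast_mul, h.fst_fst, h.snd_fst]
    simp
  have hθ : ((b * t : ℕ) : A) * θ ∈ R := by
    rw [hR, c₁.map_natCast_mul, c₂.map_natCast_mul, h.fst_snd, h.snd_snd]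
    simp
  have ht : ((t / t.gcd b : ℕ) : ℤ) ∣ c₂ (ω * ω) := by
    refine Nat.div_gcd_dvd_of_dvd_sq_mul hb.ne' ht0 hst ?_
    have := ((hR _).mp (R.mul_mem hω hω)).2
    rwa [mul_mul_mul_comm, ← Nat.cast_mul, c₂.map_natCast_mul, Nat.cast_mul (b * s),
      ← sq] at this
  have hs : ((s / s.gcd b : ℕ) : ℤ) ∣ c₁ (θ * θ) := by
    refine Nat.div_gcd_dvd_of_dvd_sq_mul hb.ne' hs0 hst.symm ?_
    have := ((hR _).mp (R.mul_mem hθ hθ)).1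
    rwa [mul_mul_mul_comm, ← Nat.cast_mul, c₁.map_natCast_mul, Nat.cast_mul (b * t),
      ← sq] at this
  obtain ⟨u, s', hu, hs'⟩ : ∃ u s' : ℕ, u = s.gcd b ∧ s = u * s' :=
    ⟨_, _, rfl, (Nat.mul_div_cancel' (Nat.gcd_dvd_left s b)).symm⟩
  obtain ⟨v, t', hv, ht'⟩ : ∃ v t' : ℕ, v = t.gcd b ∧ t = v * t' :=
    ⟨_, _, rfl, (Nat.mul_div_cancel' (Nat.gcd_dvd_left t b)).symm⟩
  have hu0 : 0 < u := Nat.pos_of_ne_zero (left_ne_zero_of_mul (hs' ▸ hs0))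
  have hv0 : 0 < v := Nat.pos_of_ne_zero (left_ne_zero_of_mul (ht' ▸ ht0))
  rw [← hu, hs', Nat.mul_div_cancel_left _ hu0] at hs
  rw [← hv, ht', Nat.mul_div_cancel_left _ hv0] at ht
  have huv : u * v ∣ b := by
    refine Nat.Coprime.mul_dvd_of_dvd_of_dvd ?_ (hu ▸ Nat.gcd_dvd_right s b)
      (hv ▸ Nat.gcd_dvd_right t b)
    exact hst.coprime_dvd_left ⟨s', hs'⟩ |>.coprime_dvd_right ⟨t', ht'⟩
  have hst' : s'.Coprime t' :=
    hst.coprime_dvd_left ⟨u, by rw [hs', mul_comm]⟩ |>.coprime_dvd_right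
      ⟨v, by rw [ht', mul_comm]⟩
  obtain ⟨F, hF, hS⟩ := h.exists_ideal (Nat.isCoprime_iff_coprime.mpr hst') hs ht
  have hT : ∀ z, z ∈ intAddSMulIdeal b F ↔
      ((b * s' : ℕ) : ℤ) ∣ c₁ z ∧ ((b * t' : ℕ) : ℤ) ∣ c₂ z := by
    intro z
    rw [mem_intAddSMulIdeal]
    constructor
    · rintro ⟨r, f, hf, rfl⟩
      obtain ⟨h1, h2⟩ := (hS f).mp ⟨0, f, hf, by simp⟩
      rw [map_add, map_add, h.fst_intCast, h.snd_intCast, zero_add, zero_add,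
        c₁.map_natCast_mul, c₂.map_natCast_mul]
      push_cast
      exact ⟨mul_dvd_mul_left _ h1, mul_dvd_mul_left _ h2⟩
    · rintro ⟨⟨j, hj⟩, ⟨k, hk⟩⟩
      obtain ⟨i, hi⟩ := h.exists_eq z
      obtain ⟨r, f, hf, hrf⟩ := (hS (((0 : ℤ) : A) + ((s' * j : ℤ) : A) * ω +
          ((t' * k : ℤ) : A) * θ)).mpr (by
        rw [h.fst_combination, h.snd_combination]
        exact ⟨dvd_mul_right _ _, dvd_mul_right _ _⟩)
      refine ⟨i + b * r, f, hf, ?_⟩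
      have : z = i + b * (((0 : ℤ) : A) + ((s' * j : ℤ) : A) * ω + ((t' * k : ℤ) : A) * θ) := by
        rw [hi, hj, hk]; push_cast; ring
      rw [this, hrf]; push_cast; ring
  obtain ⟨w, hw⟩ := huv
  refine ⟨u * v, b, F, ?_, ?_, ?_, R.one_mem, ?_, ?_, ?_⟩
  · refine ⟨w ^ 2 * (s' * t'), ?_⟩
    rw [hs', ht', hw]; ring
  · rw [mul_assoc]; exact dvd_mul_right _ _
  · have := F.mul_mem_left ((b * b * u * v : ℕ) : A) hF
    convert this using 1
    rw [hs', ht']; push_cast; ring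
  · intro z hz
    obtain ⟨h1, h2⟩ := (hR z).mp hz
    refine (hT z).mpr ⟨dvd_trans ?_ h1, dvd_trans ?_ h2⟩
    · exact Int.natCast_dvd_natCast.mpr ⟨u, by rw [hs']; ring⟩
    · exact Int.natCast_dvd_natCast.mpr ⟨v, by rw [ht']; ring⟩
  · intro z hz
    obtain ⟨⟨j, hj⟩, ⟨k, hk⟩⟩ := (hT z).mp hz
    refine (hR _).mpr ?_
    rw [c₁.map_natCast_mul, c₂.map_natCast_mul, hj, hk, hs', ht']
    exact ⟨⟨v * j, by push_cast; ring⟩, ⟨u * k, by push_cast; ring⟩⟩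
  · refine ⟨((b * s' : ℕ) : A) * ω, (hT _).mpr ?_, ((b * t' : ℕ) : A) * θ, (hT _).mpr ?_, ?_⟩
    · rw [c₁.map_natCast_mul, c₂.map_natCast_mul, h.fst_fst, h.snd_fst]
      simp
    · rw [c₁.map_natCast_mul, c₂.map_natCast_mul, h.fst_snd, h.snd_snd]
      simp
    · intro z hz
      obtain ⟨⟨j, hj⟩, ⟨k, hk⟩⟩ := (hT z).mp hz
      obtain ⟨i, hi⟩ := h.exists_eq z
      refine ⟨i, j, k, ?_⟩
      rw [hj, hk] at hi
      rw [hi]; push_cast; ring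

end IsCubicBasis

end AdaptedBasis

section RingOfIntegers

open NumberField

variable {K : Type*} [Field K] [NumberField K]

theorem exists_intCast_eq_of_mul_eq_intCast {x : 𝓞 K} {k m : ℤ} (hk : k ≠ 0)
    (h : (k : 𝓞 K) * x = m) : ∃ i : ℤ, x = i := by
  have hk' : (k : ℚ) ≠ 0 := by exact_mod_cast hk
  have hx : (algebraMap (𝓞 K) K x) = algebraMap ℚ K (m / k) := by
    have h' : (k : K) * algebraMap (𝓞 K) K x = m := by
      simpa using congrArg (algebraMap (𝓞 K) K) h
    have hk'' : (k : K) ≠ 0 := by exact_mod_cast hk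
    rw [map_div₀, map_intCast, map_intCast, eq_div_iff hk'', mul_comm]
    exact h'
  have hint : IsIntegral ℤ ((m : ℚ) / k) := by
    refine (isIntegral_algebraMap_iff (algebraMap ℚ K).injective).mp ?_
    rw [← hx]
    exact x.isIntegral_coe
  obtain ⟨i, hi⟩ := IsIntegrallyClosed.algebraMap_eq_of_integral hint
  refine ⟨i, RingOfIntegers.coe_injective ?_⟩
  rw [hx, ← hi]
  simp

theorem isTorsionFree_quotient_span_one :
    Module.IsTorsionFree ℤ (𝓞 K ⧸ Submodule.span ℤ {(1 : 𝓞 K)}) := by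
  rw [Module.isTorsionFree_iff_smul_eq_zero]
  intro k z
  obtain ⟨x, rfl⟩ := Submodule.mkQ_surjective _ z
  rw [← map_smul, Submodule.mkQ_apply, Submodule.mkQ_apply, Submodule.Quotient.mk_eq_zero,
    Submodule.Quotient.mk_eq_zero, Submodule.mem_span_singleton, Submodule.mem_span_singleton]
  rintro ⟨m, hm⟩
  by_cases hk : k = 0
  · exact Or.inl hk
  obtain ⟨i, rfl⟩ := exists_intCast_eq_of_mul_eq_intCast (x := x) (k := k) (m := m) hk
    (by simpa using hm.symm)
  exact Or.inr ⟨i, by simp⟩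

/-- A finite-index subring of the maximal order of a cubic field is diagonal in a suitable
integral basis containing `1`. -/
theorem exists_isCubicBasis (hK : Module.finrank ℚ K = 3) (R : Subring (𝓞 K))
    (hR : R.toAddSubgroup.index ≠ 0) :
    ∃ (ω θ : 𝓞 K) (c₁ c₂ : 𝓞 K →+ ℤ) (a₁ a₂ : ℕ), IsCubicBasis ω θ c₁ c₂ ∧
      (∀ x, x ∈ R ↔ (a₁ : ℤ) ∣ c₁ x ∧ (a₂ : ℤ) ∣ c₂ x) ∧
      R.toAddSubgroup.index = a₁ * a₂ := by
  set N := Submodule.span ℤ {(1 : 𝓞 K)} with hN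
  have : Module.IsTorsionFree ℤ (𝓞 K ⧸ N) := isTorsionFree_quotient_span_one
  have hrank : Module.finrank ℤ (𝓞 K ⧸ N) = 2 := by
    have h1 := N.finrank_quotient_add_finrank
    have h2 : Module.finrank ℤ ℤ = Module.finrank ℤ N :=
      (LinearEquiv.toSpanNonzeroSingleton ℤ (𝓞 K) 1 one_ne_zero).finrank_eq
    rw [← h2, Module.finrank_self, RingOfIntegers.rank, hK] at h1
    exact Nat.add_right_cancel h1
  have hq := N.mkQ_surjective
  let M := R.toAddSubgroup.map N.mkQ.toAddMonoidHom
  have hM : M.FiniteIndex :=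
    ⟨fun h0 => hR (by
      have := R.toAddSubgroup.index_map_dvd (f := N.mkQ.toAddMonoidHom) hq
      change M.index ∣ _ at this
      rwa [h0, zero_dvd_iff] at this)⟩
  have hmem : ∀ x : 𝓞 K, N.mkQ x ∈ M ↔ x ∈ R := by
    refine fun x => ⟨?_, fun hx => ⟨x, hx, rfl⟩⟩
    rintro ⟨y, hy, hxy⟩
    have h1 : y - x ∈ N := (Submodule.Quotient.eq N).mp hxy
    obtain ⟨m, hm⟩ := Submodule.mem_span_singleton.mp h1
    have : x = y - (m : 𝓞 K) := by
      rw [zsmul_one] at hm; rw [hm]; ring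
    rw [this]
    exact R.sub_mem hy (intCast_mem R m)
  let B : Module.Basis (Fin 2) ℤ (𝓞 K ⧸ N) := Module.finBasisOfFinrankEq ℤ _ hrank
  obtain ⟨b, a, ab, hab⟩ := Submodule.exists_smith_normal_form_of_rank_eq B
    (N := M.toIntSubmodule) M.finrank_eq_of_finiteIndex
  obtain ⟨ω, hω⟩ := hq (b 0)
  obtain ⟨θ, hθ⟩ := hq (b 1)
  have hone : N.mkQ 1 = 0 := by
    rw [Submodule.mkQ_apply, Submodule.Quotient.mk_eq_zero]
    exact Submodule.mem_span_singleton_self 1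
  let c : Fin 2 → 𝓞 K →+ ℤ := fun i => ((b.coord i).comp N.mkQ).toAddMonoidHom
  have hc : ∀ i x, c i x = b.repr (N.mkQ x) i := fun _ _ => rfl
  have hbasis : IsCubicBasis ω θ (c 0) (c 1) := by
    refine ⟨?_, ?_, ?_, ?_, ?_, ?_, fun x => ?_⟩
    any_goals simp [hc, hone, hω, hθ, -Submodule.mkQ_apply]
    have h1 : N.mkQ (x - (c 0 x * ω + c 1 x * θ)) = 0 := by
      rw [← zsmul_eq_mul, ← zsmul_eq_mul, map_sub, map_add, map_zsmul, map_zsmul, hω, hθ, hc, hc,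
        sub_eq_zero, ← Fin.sum_univ_two (fun i => b.repr (N.mkQ x) i • b i), b.sum_repr]
    rw [Submodule.mkQ_apply, Submodule.Quotient.mk_eq_zero, Submodule.mem_span_singleton] at h1
    obtain ⟨m, hm⟩ := h1
    refine ⟨m, ?_⟩
    rw [zsmul_one] at hm
    simp only [hm, hc]
    ring
  have hmemR : ∀ x, x ∈ R ↔ ((a 0).natAbs : ℤ) ∣ c 0 x ∧ ((a 1).natAbs : ℤ) ∣ c 1 x := by
    intro x
    rw [Int.natAbs_dvd, Int.natAbs_dvd, ← hmem]
    constructor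
    · intro hx
      have h1 := ab.sum_repr ⟨N.mkQ x, hx⟩
      have h2 := congrArg (fun z : M.toIntSubmodule => (z : 𝓞 K ⧸ N)) h1
      simp only [Fin.sum_univ_two, Submodule.coe_add, Submodule.coe_smul, hab] at h2
      constructor
      · rw [hc, ← h2]; simp
      · rw [hc, ← h2]; simp
    · rintro ⟨⟨j, hj⟩, ⟨k, hk⟩⟩
      have h1 := b.sum_repr (N.mkQ x)
      rw [Fin.sum_univ_two, ← hc, ← hc, hj, hk, mul_comm, mul_smul, ← hab, mul_comm, mul_smul,
        ← hab] at h1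
      rw [← h1]
      exact M.add_mem (M.zsmul_mem (ab 0).2 j) (M.zsmul_mem (ab 1).2 k)
  refine ⟨ω, θ, c 0, c 1, (a 0).natAbs, (a 1).natAbs, hbasis, hmemR, ?_⟩
  let φ : 𝓞 K →+ ZMod (a 0).natAbs × ZMod (a 1).natAbs :=
    ((Int.castAddHom _).comp (c 0)).prod ((Int.castAddHom _).comp (c 1))
  have hφ : ∀ x, φ x = (((c 0 x : ℤ) : ZMod (a 0).natAbs), ((c 1 x : ℤ) : ZMod (a 1).natAbs)) :=
    fun _ => rfl
  have hker : φ.ker = R.toAddSubgroup := by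
    ext x
    rw [AddMonoidHom.mem_ker, Subring.mem_toAddSubgroup, hmemR]
    simp [hφ, Prod.ext_iff, ZMod.intCast_zmod_eq_zero_iff_dvd]
  have hsurj : Function.Surjective φ := by
    rintro ⟨y, z⟩
    obtain ⟨j, rfl⟩ := ZMod.intCast_surjective y
    obtain ⟨k, rfl⟩ := ZMod.intCast_surjective z
    refine ⟨((0 : ℤ) : 𝓞 K) + j * ω + k * θ, ?_⟩
    rw [hφ, hbasis.fst_combination, hbasis.snd_combination]
  rw [← hker, AddSubgroup.index_ker, AddMonoidHom.range_eq_top.mpr hsurj, Nat.card_congr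
    AddSubgroup.topEquiv.toEquiv, Nat.card_prod, Nat.card_zmod, Nat.card_zmod]

end RingOfIntegers

section Counting

open NumberField

variable {K : Type*} [Field K] [NumberField K]

/-- Up to a power of `τ(n)`, the number of orders of index `n` in a cubic field is at most the
sum of all `g` with `g ^ 3 ∣ n`. -/
theorem exists_finset_subring_index_eq (hK : Module.finrank ℚ K = 3) {n : ℕ} (hn : n ≠ 0) :
    ∃ s : Finset (AddSubgroup (𝓞 K)),
      s.card ≤ n.divisors.card ^ 6 * ∑ g ∈ n.divisors with g ^ 3 ∣ n, g ∧
      ∀ R : Subring (𝓞 K), R.toAddSubgroup.index = n → R.toAddSubgroup ∈ s := by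
  obtain ⟨I, hIcard, hI⟩ := hasAtMostDivisors_span_natCast (K := K) hn
  rw [hK] at hIcard
  have hW : ∀ (g : ℕ) (T : AddSubgroup (𝓞 K)), ∃ s : Finset (AddSubgroup (𝓞 K)), g ≠ 0 →
      s.card ≤ g.divisors.card ^ 2 * g ∧ ∀ H ∈ boundedSubgroups g T, H ∈ s := by
    intro g T
    by_cases hg : g = 0
    · exact ⟨∅, fun h => (h hg).elim⟩
    · obtain ⟨s, h⟩ := exists_finset_boundedSubgroups g hg T
      exact ⟨s, fun _ => h⟩
  choose W hW using hW
  refine ⟨(n.divisors.filter (fun g => g ^ 3 ∣ n)).biUnion fun g => n.divisors.biUnion fun b =>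
    I.biUnion fun F => W g (intAddSMulIdeal b F), ?_, ?_⟩
  · calc _ ≤ ∑ g ∈ n.divisors with g ^ 3 ∣ n, ∑ b ∈ n.divisors, ∑ F ∈ I,
          (W g (intAddSMulIdeal b F)).card :=
        Finset.card_biUnion_le.trans <| Finset.sum_le_sum fun g _ =>
          Finset.card_biUnion_le.trans <| Finset.sum_le_sum fun b _ => Finset.card_biUnion_le
      _ ≤ ∑ g ∈ n.divisors with g ^ 3 ∣ n, ∑ b ∈ n.divisors, ∑ F ∈ I,
          n.divisors.card ^ 2 * g := by
        gcongr with g hg b _ F _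
        have hg' := (Finset.mem_filter.mp hg).1
        refine (hW g _ (Nat.pos_of_mem_divisors hg').ne').1.trans ?_
        gcongr
        exact Nat.dvd_of_mem_divisors hg'
      _ = n.divisors.card ^ 3 * I.card * ∑ g ∈ n.divisors with g ^ 3 ∣ n, g := by
        simp only [Finset.sum_const, smul_eq_mul, Finset.mul_sum]
        exact Finset.sum_congr rfl fun g _ => by ring
      _ ≤ n.divisors.card ^ 3 * n.divisors.card ^ 3 * ∑ g ∈ n.divisors with g ^ 3 ∣ n, g := by
        gcongr
      _ = _ := by ring
  · intro R hR
    obtain ⟨ω, θ, c₁, c₂, a₁, a₂, hb, hmem, hidx⟩ := exists_isCubicBasis hK R (hR ▸ hn)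
    rw [hR] at hidx
    obtain ⟨g, b, F, hg, hbn, hF, hRF⟩ := hb.exists_mem_boundedSubgroups
      (left_ne_zero_of_mul (hidx ▸ hn)) (right_ne_zero_of_mul (hidx ▸ hn)) hmem
    rw [← hidx] at hg hbn hF
    have hgn : g ∣ n := (dvd_pow_self g three_ne_zero).trans hg
    simp only [Finset.mem_biUnion, Finset.mem_filter, Nat.mem_divisors]
    exact ⟨g, ⟨⟨hgn, hn⟩, hg⟩, b, ⟨hbn, hn⟩, F,
      hI F (Ideal.dvd_iff_le.mpr ((Ideal.span_singleton_le_iff_mem F).mpr hF)),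
      (hW g _ (ne_zero_of_dvd_ne_zero hn hgn)).2 _ hRF⟩

theorem sum_sum_cube_dvd_le (N : ℕ) :
    ((∑ n ∈ Finset.Ioc 0 N, ∑ g ∈ n.divisors with g ^ 3 ∣ n, g : ℕ) : ℝ) ≤ 2 * N := by
  have h1 : ∑ n ∈ Finset.Ioc 0 N, ∑ g ∈ n.divisors with g ^ 3 ∣ n, g ≤
      ∑ g ∈ Finset.Ioc 0 N, N / g ^ 3 * g := by
    calc _ = ∑ g ∈ Finset.Ioc 0 N, ∑ n ∈ Finset.Ioc 0 N with g ∣ n ∧ g ^ 3 ∣ n, g := by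
          refine Finset.sum_comm' fun n g => ?_
          simp only [Finset.mem_Ioc, Finset.mem_filter, Nat.mem_divisors]
          constructor
          · rintro ⟨⟨h1, h2⟩, ⟨h3, -⟩, h4⟩
            exact ⟨⟨⟨h1, h2⟩, h3, h4⟩, Nat.pos_of_dvd_of_pos h3 h1, (Nat.le_of_dvd h1 h3).trans h2⟩
          · rintro ⟨⟨⟨h1, h2⟩, h3, h4⟩, -⟩
            exact ⟨⟨h1, h2⟩, ⟨h3, h1.ne'⟩, h4⟩
      _ ≤ _ := by
        gcongr with g _
        rw [Finset.sum_const, smul_eq_mul, ← Nat.Ioc_filter_dvd_card_eq_div]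
        gcongr with n _
        exact And.right
  have h2 : ∑ g ∈ Finset.Ioc 0 N, ((g : ℝ) ^ 2)⁻¹ ≤ 2 := by
    rcases Nat.eq_zero_or_pos N with rfl | hN
    · simp
    have := sum_Ioc_inv_sq_le_sub (α := ℝ) one_ne_zero hN
    rw [← Finset.sum_Ioc_consecutive (fun g : ℕ => ((g : ℝ) ^ 2)⁻¹) zero_le_one hN]
    have h0 : (0 : ℝ) ≤ (N : ℝ)⁻¹ := by positivity
    simp only [Nat.cast_one, inv_one] at this
    have h3 : ∑ g ∈ Finset.Ioc (0 : ℕ) 1, ((g : ℝ) ^ 2)⁻¹ = 1 := by simp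
    linarith
  calc _ ≤ ((∑ g ∈ Finset.Ioc 0 N, N / g ^ 3 * g : ℕ) : ℝ) := by exact_mod_cast h1
    _ ≤ ∑ g ∈ Finset.Ioc 0 N, N * ((g : ℝ) ^ 2)⁻¹ := by
      push_cast
      refine Finset.sum_le_sum fun g hg => ?_
      have hg0 : (0 : ℝ) < g := by exact_mod_cast (Finset.mem_Ioc.mp hg).1
      calc ((N / g ^ 3 : ℕ) : ℝ) * g ≤ (N / (g ^ 3 : ℕ) : ℝ) * g := by
            gcongr; exact Nat.cast_div_le
        _ = _ := by push_cast; field_simp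
    _ ≤ 2 * N := by
      rw [← Finset.mul_sum, mul_comm]
      gcongr

end Counting

/-- Uniform count of orders: the number of finite-index subrings of the ring of integers
of a cubic field `K` of additive index at most `Z` is `O_ε(Z^{1+ε}·|Δ(K)|^ε)`. -/
theorem count_orders_of_cubic_field :
    ∀ ε > (0 : ℝ), ∃ C > (0 : ℝ),
      ∀ (K : Type) (_ : Field K) (_ : NumberField K), Module.finrank ℚ K = 3 →
        ∀ Z : ℝ, 1 ≤ Z →
          (Nat.card {R : Subring (NumberField.RingOfIntegers K) //
              R.toAddSubgroup.index ≠ 0 ∧ (R.toAddSubgroup.index : ℝ) ≤ Z} : ℝ) ≤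
            C * Z ^ (1 + ε) * |(NumberField.discr K : ℝ)| ^ ε := by
  intro ε hε
  obtain ⟨C, hC, hdiv⟩ := exists_card_divisors_le_mul_rpow (ε := ε / 6) (by positivity)
  refine ⟨2 * C ^ 6, by positivity, ?_⟩
  intro K _ _ hK Z hZ
  have hZ0 : 0 < Z := by linarith
  have hs : ∀ n : ℕ, ∃ s : Finset (AddSubgroup (NumberField.RingOfIntegers K)), n ≠ 0 →
      s.card ≤ n.divisors.card ^ 6 * ∑ g ∈ n.divisors with g ^ 3 ∣ n, g ∧
      ∀ R : Subring (NumberField.RingOfIntegers K),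
        R.toAddSubgroup.index = n → R.toAddSubgroup ∈ s := by
    intro n
    by_cases hn : n = 0
    · exact ⟨∅, fun h => (h hn).elim⟩
    · obtain ⟨s, h⟩ := exists_finset_subring_index_eq hK hn
      exact ⟨s, fun _ => h⟩
  choose s hs using hs
  set N := ⌊Z⌋₊
  have hNZ : (N : ℝ) ≤ Z := Nat.floor_le hZ0.le
  have hcard : Nat.card {R : Subring (NumberField.RingOfIntegers K) //
      R.toAddSubgroup.index ≠ 0 ∧ (R.toAddSubgroup.index : ℝ) ≤ Z} ≤
      ((Finset.Ioc 0 N).biUnion s).card := by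
    have hmem : ∀ R : {R : Subring (NumberField.RingOfIntegers K) //
        R.toAddSubgroup.index ≠ 0 ∧ (R.toAddSubgroup.index : ℝ) ≤ Z},
        R.1.toAddSubgroup ∈ (Finset.Ioc 0 N).biUnion s := fun R =>
      Finset.mem_biUnion.mpr ⟨R.1.toAddSubgroup.index,
        Finset.mem_Ioc.mpr ⟨Nat.pos_of_ne_zero R.2.1, Nat.le_floor R.2.2⟩,
        (hs _ R.2.1).2 R.1 rfl⟩
    refine (Nat.card_le_card_of_injective (fun R => (⟨_, hmem R⟩ : (Finset.Ioc 0 N).biUnion s))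
      fun R R' h => Subtype.ext ?_).trans (Nat.card_eq_fintype_card.trans (Fintype.card_coe _)).le
    exact Subring.toAddSubgroup_injective (Subtype.ext_iff.mp h)
  have hterm : ∀ n ∈ Finset.Ioc 0 N, ((s n).card : ℝ) ≤
      C ^ 6 * Z ^ ε * ((∑ g ∈ n.divisors with g ^ 3 ∣ n, g : ℕ) : ℝ) := by
    intro n hn
    obtain ⟨hn0, hnN⟩ := Finset.mem_Ioc.mp hn
    have hnZ : (n : ℝ) ≤ Z := (Nat.cast_le.mpr hnN).trans hNZ
    have h1 : ((s n).card : ℝ) ≤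
        (n.divisors.card : ℝ) ^ 6 * ((∑ g ∈ n.divisors with g ^ 3 ∣ n, g : ℕ) : ℝ) := by
      exact_mod_cast (hs n hn0.ne').1
    refine h1.trans ?_
    gcongr
    calc (n.divisors.card : ℝ) ^ 6 ≤ (C * (n : ℝ) ^ (ε / 6)) ^ 6 := by
          gcongr; exact hdiv n hn0.ne'
      _ ≤ (C * Z ^ (ε / 6)) ^ 6 := by gcongr
      _ = C ^ 6 * Z ^ ε := by
        rw [mul_pow, ← Real.rpow_natCast (Z ^ (ε / 6)), ← Real.rpow_mul hZ0.le]
        congr 2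
        push_cast; ring
  have hdiscr : 1 ≤ |(NumberField.discr K : ℝ)| ^ ε := by
    refine Real.one_le_rpow ?_ hε.le
    exact_mod_cast Int.one_le_abs (NumberField.discr_ne_zero K)
  calc _ ≤ (((Finset.Ioc 0 N).biUnion s).card : ℝ) := by exact_mod_cast hcard
    _ ≤ ∑ n ∈ Finset.Ioc 0 N, ((s n).card : ℝ) := by exact_mod_cast Finset.card_biUnion_le
    _ ≤ ∑ n ∈ Finset.Ioc 0 N,
        C ^ 6 * Z ^ ε * ((∑ g ∈ n.divisors with g ^ 3 ∣ n, g : ℕ) : ℝ) :=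
      Finset.sum_le_sum hterm
    _ ≤ C ^ 6 * Z ^ ε * (2 * Z) := by
      rw [← Finset.mul_sum]
      gcongr
      have := sum_sum_cube_dvd_le N
      push_cast at this ⊢
      linarith
    _ = 2 * C ^ 6 * Z ^ (1 + ε) * 1 := by
      rw [Real.rpow_add hZ0, Real.rpow_one]; ring
    _ ≤ _ := by gcongr
end
end
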